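/- Let w ∈ F₂ be non-trivial, not a proper power, and assume that w does not lie in the subgroup ⟨x^n, y⟩ for any basis (x, y) of F₂ and any integer n ≥ 2. Then F₂ admits no cyclic splitting as an amalgamated product relative to w: there is no proper amalgamated product splitting A ∗_C B of F₂ with C infinite cyclic such that some conjugate of w lies in A or in B. -/

import Mathlib

/-- The two-element family of subgroups `A`, `B`. -/
def amalgFam {G : Type*} [Group G] (A B : Subgroup G) : Bool → Subgroup G :=
  fun b => bif b then A else B

theorem inf_le_amalgFam {G : Type*} [Group G] (A B : Subgroup G) (b : Bool) :
    A ⊓ B ≤ amalgFam A B b := by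
  cases b
  · exact inf_le_right
  · exact inf_le_left

/-- The diagram of inclusions `A ∩ B ↪ A`, `A ∩ B ↪ B`. -/
def amalgMaps {G : Type*} [Group G] (A B : Subgroup G) :
    ∀ b : Bool, ↥(A ⊓ B) →* ↥(amalgFam A B b) :=
  fun b => Subgroup.inclusion (inf_le_amalgFam A B b)

/-- The canonical homomorphism from the amalgamated free product (pushout) of the
inclusions `A ∩ B ↪ A` and `A ∩ B ↪ B` back to `G`. -/
def amalgToGroup {G : Type*} [Group G] (A B : Subgroup G) :
    Monoid.PushoutI (amalgMaps A B) →* G :=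
  Monoid.PushoutI.lift (fun b => (amalgFam A B b).subtype) (A ⊓ B).subtype
    (fun b => by ext x; rfl)

/-- `G` splits as a proper amalgamated product `A ∗_{A ∩ B} B`. -/
def SplitsAsAmalgam {G : Type*} [Group G] (A B : Subgroup G) : Prop :=
  A ≠ A ⊓ B ∧ B ≠ A ⊓ B ∧ Function.Bijective (amalgToGroup A B)

/-- A subgroup `C` of `G` is malnormal if `gCg⁻¹ ∩ C = 1` for all `g ∉ C`. -/
def IsMalnormal {G : Type*} [Group G] (C : Subgroup G) : Prop :=
  ∀ g : G, g ∉ C → ∀ c ∈ C, g * c * g⁻¹ ∈ C → c = 1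

/-- An element of a group is a proper power if it is `v ^ k` for some `k ≥ 2`. -/
def IsProperPower {G : Type*} [Group G] (w : G) : Prop :=
  ∃ (v : G) (k : ℕ), 2 ≤ k ∧ w = v ^ k

section MagnusOrder

open Polynomial Matrix

/-- The nilpotent matrix unit attached to a generator. -/
def magnusNilpotent (i : Fin 2) : Matrix (Fin 2) (Fin 2) ℤ :=
  if i = 0 then !![0, 1; 0, 0] else !![0, 0; 1, 0]

theorem magnusNilpotent_mul_self (i : Fin 2) : magnusNilpotent i * magnusNilpotent i = 0 := by
  fin_cases i <;> ext j k <;> fin_cases j <;> fin_cases k <;> simp [magnusNilpotent]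

/-- The unit `1 + t N` attached to a generator. -/
noncomputable def magnusUnit (i : Fin 2) : ((Matrix (Fin 2) (Fin 2) ℤ)[X])ˣ where
  val := 1 + C (magnusNilpotent i) * X
  inv := 1 - C (magnusNilpotent i) * X
  val_inv := by
    have h : C (magnusNilpotent i) * X * (C (magnusNilpotent i) * X) = 0 := by
      rw [mul_assoc, ← mul_assoc X, X_mul_C, mul_assoc, ← mul_assoc, ← C_mul,
        magnusNilpotent_mul_self]
      simp
    rw [add_mul, mul_sub, mul_sub, h]
    simp
  inv_val := by
    have h : C (magnusNilpotent i) * X * (C (magnusNilpotent i) * X) = 0 := by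
      rw [mul_assoc, ← mul_assoc X, X_mul_C, mul_assoc, ← mul_assoc, ← C_mul,
        magnusNilpotent_mul_self]
      simp
    rw [sub_mul, mul_add, mul_add, h]
    simp

/-- The representation of `F₂` sending the generators to elementary matrices over `ℤ[t]`. -/
noncomputable def magnusRep : FreeGroup (Fin 2) →* ((Matrix (Fin 2) (Fin 2) ℤ)[X])ˣ :=
  FreeGroup.lift magnusUnit

theorem coeff_zero_magnusRep (g : FreeGroup (Fin 2)) :
    ((magnusRep g : ((Matrix (Fin 2) (Fin 2) ℤ)[X])ˣ) : (Matrix (Fin 2) (Fin 2) ℤ)[X]).coeff 0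
      = 1 := by
  induction g using FreeGroup.induction_on with
  | C1 => simp
  | of i => simp [magnusRep, magnusUnit]
  | inv_of i _ => simp [magnusRep, magnusUnit]
  | mul a b ha hb => rw [map_mul, Units.val_mul, mul_coeff_zero, ha, hb, one_mul]

/-- Evaluation of a polynomial with matrix coefficients at `t = 3`. -/
noncomputable def evalThree :
    (Matrix (Fin 2) (Fin 2) ℤ)[X] →+* Matrix (Fin 2) (Fin 2) ℤ :=
  eval₂RingHom' (RingHom.id _) 3 fun a => (Nat.cast_commute 3 a).symm

theorem evalThree_magnusRep_letter (a : Fin 2 × Bool) (v : Fin 2 → ℤ) :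
    (evalThree (magnusRep (FreeGroup.mk [a]) : ((Matrix (Fin 2) (Fin 2) ℤ)[X])ˣ) *ᵥ v) =
      Function.update v a.1 (v a.1 + 3 * (bif a.2 then 1 else -1) * v (1 - a.1)) := by
  obtain ⟨i, b⟩ := a
  ext k
  fin_cases i <;> cases b <;> fin_cases k <;>
  simp [magnusRep, magnusUnit, evalThree, magnusNilpotent, Matrix.mulVec,
    dotProduct, Fin.sum_univ_two, Function.update] <;> ring

/-- The ping-pong domain of a letter. -/
def pingPongDomain (a : Fin 2 × Bool) (v : Fin 2 → ℤ) : Prop :=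
  0 < (bif a.2 then 1 else -1) * (v a.1 * v (1 - a.1)) ∧ |v (1 - a.1)| < |v a.1|

theorem ping_pong_int {p q s : ℤ} (hs : s = 1 ∨ s = -1) (hq : q ≠ 0)
    (h : 0 < s * (p * q) ∨ |p| < |q|) :
    0 < s * ((p + 3 * s * q) * q) ∧ |q| < |p + 3 * s * q| := by
  wlog hq' : 0 < q generalizing p q
  · have := this (p := -p) (q := -q) (by simpa using hq) (by simpa using h) (by omega)
    rw [show -p + 3 * s * -q = -(p + 3 * s * q) by ring, abs_neg, abs_neg, neg_mul_neg] at this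
    exact this
  wlog hs' : s = 1 generalizing p s
  · have := this (p := -p) (s := 1) (Or.inl rfl) (by
      rcases hs with rfl | rfl
      · exact absurd rfl hs'
      · simpa using h) rfl
    rcases hs with rfl | rfl
    · exact absurd rfl hs'
    · rw [show -p + 3 * 1 * q = -(p + 3 * -1 * q) by ring, abs_neg, neg_mul, one_mul] at this
      rwa [neg_one_mul]
  subst hs'
  have hp : -q < p := by
    rcases h with h | h
    · have : 0 < p := by
        rw [one_mul] at h
        exact pos_of_mul_pos_left h hq'.le
      omega
    · rw [abs_of_pos hq'] at h
      exact (abs_lt.mp h).1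
  have h2 : 0 < p + 3 * 1 * q := by omega
  rw [abs_of_pos hq', abs_of_pos h2]
  exact ⟨by rw [one_mul]; positivity, by omega⟩

theorem evalThree_mulVec_mem_pingPongDomain (a : Fin 2 × Bool)
    (L : List (Fin 2 × Bool)) (h : FreeGroup.IsReduced (a :: L)) :
    pingPongDomain a (evalThree (magnusRep (FreeGroup.mk (a :: L)) :
      ((Matrix (Fin 2) (Fin 2) ℤ)[X])ˣ) *ᵥ ![1, 1]) := by
  have hne : ∀ i : Fin 2, 1 - i ≠ i := by decide
  have hsign : ∀ b : Bool,
      (bif b then (1 : ℤ) else -1) = 1 ∨ (bif b then (1 : ℤ) else -1) = -1 := by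
    decide
  induction L generalizing a with
  | nil =>
    obtain ⟨i, b⟩ := a
    rw [evalThree_magnusRep_letter]
    fin_cases i <;> cases b <;> simp [pingPongDomain]
  | cons c L ih =>
    rw [FreeGroup.isReduced_cons_cons] at h
    have hc := ih c h.2
    have hm : FreeGroup.mk (a :: c :: L) = FreeGroup.mk [a] * FreeGroup.mk (c :: L) := rfl
    rw [hm, map_mul, Units.val_mul, map_mul, ← Matrix.mulVec_mulVec, evalThree_magnusRep_letter]
    generalize evalThree (magnusRep (FreeGroup.mk (c :: L)) :
      ((Matrix (Fin 2) (Fin 2) ℤ)[X])ˣ) *ᵥ ![1, 1] = v at hc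
    obtain ⟨i, b⟩ := a
    obtain ⟨j, d⟩ := c
    simp only [pingPongDomain, Function.update_self, Function.update_of_ne (hne _)] at hc ⊢
    have hv : v (1 - i) ≠ 0 := by
      have h0 := hc.1
      have hij : j = i ∨ j = 1 - i := by fin_cases i <;> fin_cases j <;> simp
      rintro hv
      rcases hij with rfl | rfl <;> simp [hv] at h0
    refine ping_pong_int (hsign b) hv ?_
    by_cases hij : i = j
    · subst hij
      have hbd : b = d := h.1 rfl
      subst hbd
      exact Or.inl hc.1
    · have hj : j = 1 - i := by fin_cases i <;> fin_cases j <;> simp_all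
      have hji : 1 - j = i := by rw [hj]; exact sub_sub_cancel 1 i
      rw [hji] at hc
      rw [← hj]
      exact Or.inr hc.2

theorem magnusRep_injective : Function.Injective magnusRep := by
  rw [injective_iff_map_eq_one]
  intro g hg
  by_contra hne
  have hw : g.toWord ≠ [] := by simpa using hne
  obtain ⟨a, L, hL⟩ := List.exists_cons_of_ne_nil hw
  have := evalThree_mulVec_mem_pingPongDomain a L (hL ▸ FreeGroup.isReduced_toWord)
  rw [← hL, FreeGroup.mk_toWord, hg] at this
  have h2 := this.2
  have h1 : ∀ i : Fin 2, (![1, 1] : Fin 2 → ℤ) i = 1 := by decide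
  simp [h1] at h2

/-- The coefficient sequence of the matrix of an element, ordered lexicographically. -/
noncomputable def magnusSeq (g : FreeGroup (Fin 2)) :
    Lex (ℕ → Lex (Fin 2 → Lex (Fin 2 → ℤ))) :=
  toLex fun n => toLex fun i => toLex fun j =>
    ((magnusRep g : ((Matrix (Fin 2) (Fin 2) ℤ)[X])ˣ) : (Matrix (Fin 2) (Fin 2) ℤ)[X]).coeff n i j

theorem magnusSeq_injective : Function.Injective magnusSeq := by
  intro g h hgh
  apply magnusRep_injective
  ext n i j
  exact congrFun (congrFun (congrFun hgh n) i) j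

/-- Conjugation does not change the leading term of a difference of matrices. -/
theorem coeff_units_conj {R : Type*} [Ring R] {d : ℕ} (u : (R[X])ˣ) (D : R[X])
    (hu : (u : R[X]).coeff 0 = 1) (hu' : ((u⁻¹ : (R[X])ˣ) : R[X]).coeff 0 = 1)
    (hD : ∀ k < d, D.coeff k = 0) :
    (∀ k < d, ((u : R[X]) * D * ((u⁻¹ : (R[X])ˣ) : R[X])).coeff k = 0) ∧
      ((u : R[X]) * D * ((u⁻¹ : (R[X])ˣ) : R[X])).coeff d = D.coeff d := by
  obtain ⟨E, rfl⟩ := X_pow_dvd_iff.mpr hD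
  have key : (u : R[X]) * (X ^ d * E) * ((u⁻¹ : (R[X])ˣ) : R[X]) =
      X ^ d * ((u : R[X]) * E * ((u⁻¹ : (R[X])ˣ) : R[X])) := by
    rw [← mul_assoc (u : R[X]), ← X_pow_mul]
    simp only [mul_assoc]
  rw [key]
  refine ⟨X_pow_dvd_iff.mp (dvd_mul_right _ _), ?_⟩
  have h1 := coeff_X_pow_mul ((u : R[X]) * E * ((u⁻¹ : (R[X])ˣ) : R[X])) d 0
  have h2 := coeff_X_pow_mul E d 0
  rw [zero_add] at h1 h2
  rw [h1, h2, mul_coeff_zero, mul_coeff_zero, hu, hu', one_mul, mul_one]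

theorem magnusSeq_conj_lt (g a b : FreeGroup (Fin 2)) (h : magnusSeq a < magnusSeq b) :
    magnusSeq (g * a * g⁻¹) < magnusSeq (g * b * g⁻¹) := by
  obtain ⟨d, hd, hlt⟩ := h
  have hcoe : ∀ c : FreeGroup (Fin 2),
      ((magnusRep (g * c * g⁻¹) : ((Matrix (Fin 2) (Fin 2) ℤ)[X])ˣ) :
        (Matrix (Fin 2) (Fin 2) ℤ)[X]) =
      (magnusRep g : ((Matrix (Fin 2) (Fin 2) ℤ)[X])ˣ) *
        (magnusRep c : ((Matrix (Fin 2) (Fin 2) ℤ)[X])ˣ) *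
        (((magnusRep g)⁻¹ : ((Matrix (Fin 2) (Fin 2) ℤ)[X])ˣ) :
          (Matrix (Fin 2) (Fin 2) ℤ)[X]) := by
    intro c; simp
  have hg' : ((((magnusRep g)⁻¹ : ((Matrix (Fin 2) (Fin 2) ℤ)[X])ˣ) :
      (Matrix (Fin 2) (Fin 2) ℤ)[X])).coeff 0 = 1 := by
    rw [← map_inv]; exact coeff_zero_magnusRep _
  obtain ⟨h1, h2⟩ := coeff_units_conj (d := d) (magnusRep g)
    ((magnusRep b : ((Matrix (Fin 2) (Fin 2) ℤ)[X])ˣ) -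
      (magnusRep a : ((Matrix (Fin 2) (Fin 2) ℤ)[X])ˣ)) (coeff_zero_magnusRep g) hg' (by
      intro k hk
      rw [coeff_sub, sub_eq_zero]
      ext i j
      exact (congrFun (congrFun (hd k hk) i) j).symm)
  rw [mul_sub, sub_mul, ← hcoe, ← hcoe] at h1 h2
  refine ⟨d, fun k hk => ?_, ?_⟩
  · funext i j
    have := h1 k hk
    rw [coeff_sub, sub_eq_zero] at this
    exact (congrFun (congrFun this i) j).symm
  · rw [← sub_pos] at hlt ⊢
    refine lt_of_lt_of_eq hlt ?_
    funext i j
    have := congrFun (congrFun h2 i) j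
    rw [coeff_sub, coeff_sub] at this
    exact this.symm

theorem exists_conj_invariant_linearOrder :
    ∃ _ : LinearOrder (FreeGroup (Fin 2)), ∀ g a b : FreeGroup (Fin 2),
      a ≤ b → g * a * g⁻¹ ≤ g * b * g⁻¹ := by
  refine ⟨LinearOrder.lift' magnusSeq magnusSeq_injective, fun g a b h => ?_⟩
  rcases eq_or_lt_of_le (α := Lex (ℕ → Lex (Fin 2 → Lex (Fin 2 → ℤ))))
    (show magnusSeq a ≤ magnusSeq b from h) with h | h
  · rw [magnusSeq_injective h]
    exact le_refl (α := Lex (ℕ → Lex (Fin 2 → Lex (Fin 2 → ℤ)))) _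
  · exact le_of_lt (α := Lex (ℕ → Lex (Fin 2 → Lex (Fin 2 → ℤ)))) (magnusSeq_conj_lt g a b h)

end MagnusOrder

section Centralizers

theorem FreeGroup.fst_head_toWord_eq_of_commute {α : Type*} [DecidableEq α] {z : FreeGroup α}
    {i : α} (h : Commute z (FreeGroup.of i)) {a : α × Bool} {L : List (α × Bool)}
    (hz : z.toWord = a :: L) : a.1 = i := by
  by_contra hne
  have hred : FreeGroup.IsReduced ((i, true) :: z.toWord) := by
    rw [hz, FreeGroup.isReduced_cons_cons, ← hz]
    exact ⟨fun h => absurd h.symm hne, FreeGroup.isReduced_toWord⟩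
  have h1 : (FreeGroup.of i * z).toWord = (i, true) :: z.toWord := by
    rw [FreeGroup.toWord_mul, FreeGroup.toWord_of, List.singleton_append, hred.reduce_eq]
  have h2 : (i, true) :: z.toWord = z.toWord ++ [(i, true)] := by
    have hs := FreeGroup.toWord_mul_sublist z (FreeGroup.of i)
    rw [h.eq, h1, FreeGroup.toWord_of] at hs
    exact hs.eq_of_length (by simp)
  rw [hz, List.cons_append] at h2
  exact hne (congrArg Prod.fst (List.cons.inj h2).1).symm

theorem FreeGroup.eq_one_of_commute_of {α : Type*} [DecidableEq α] {z : FreeGroup α} {i j : α}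
    (hij : i ≠ j) (hi : Commute z (FreeGroup.of i)) (hj : Commute z (FreeGroup.of j)) :
    z = 1 := by
  by_contra hne
  have hw : z.toWord ≠ [] := by simpa using hne
  obtain ⟨a, L, hL⟩ := List.exists_cons_of_ne_nil hw
  exact hij ((FreeGroup.fst_head_toWord_eq_of_commute hi hL).symm.trans
    (FreeGroup.fst_head_toWord_eq_of_commute hj hL))

theorem IsFreeGroup.exists_forall_mem_zpowers (G : Type*) [Group G] [IsFreeGroup G]
    [Subsingleton (IsFreeGroup.Generators G)] : ∃ y : G, ∀ g, g ∈ Subgroup.zpowers y := by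
  obtain ⟨y, hy⟩ : ∃ y : G, ∀ i, IsFreeGroup.of i = y := by
    rcases isEmpty_or_nonempty (IsFreeGroup.Generators G) with h | ⟨⟨i⟩⟩
    · exact ⟨1, fun i => h.elim i⟩
    · exact ⟨IsFreeGroup.of i, fun j => by rw [Subsingleton.elim j i]⟩
  refine ⟨y, fun g => ?_⟩
  obtain ⟨w, rfl⟩ := (IsFreeGroup.mulEquiv G).surjective g
  have hof : ∀ i, IsFreeGroup.mulEquiv G (FreeGroup.of i) ∈ Subgroup.zpowers y := by
    intro i
    rw [← hy i]
    exact Subgroup.mem_zpowers _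
  induction w using FreeGroup.induction_on with
  | C1 => rw [map_one]; exact one_mem _
  | of i => exact hof i
  | inv_of i _ => rw [map_inv]; exact inv_mem (hof i)
  | mul a b ha hb => rw [map_mul]; exact mul_mem ha hb

theorem IsFreeGroup.subsingleton_generators_of_commute {G : Type*} [Group G] [IsFreeGroup G]
    {z : G} (hz : z ≠ 1) (hc : ∀ g, Commute z g) :
    Subsingleton (IsFreeGroup.Generators G) := by
  classical
  refine ⟨fun i j => by_contra fun hij => hz ?_⟩
  have h : ∀ i, Commute (IsFreeGroup.toFreeGroup G z) (FreeGroup.of i) := by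
    intro i
    have := (hc ((IsFreeGroup.toFreeGroup G).symm (FreeGroup.of i))).map
      (IsFreeGroup.toFreeGroup G)
    simpa using this
  have := FreeGroup.eq_one_of_commute_of hij (h i) (h j)
  simpa using this

/-- Every non-trivial element of a free group is a power of one that generates its own
centralizer. -/
theorem FreeGroup.exists_root {α : Type*} {f : FreeGroup α} (hf : f ≠ 1) :
    ∃ r : FreeGroup α, f ∈ Subgroup.zpowers r ∧ ∀ g, Commute g r → g ∈ Subgroup.zpowers r := by
  have hfZ : f ∈ Subgroup.centralizer {f} := by simp [Subgroup.mem_centralizer_iff]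
  have : Subsingleton (IsFreeGroup.Generators (Subgroup.centralizer {f})) := by
    refine IsFreeGroup.subsingleton_generators_of_commute (z := ⟨f, hfZ⟩)
      (fun h => hf (congrArg Subtype.val h)) ?_
    rintro ⟨g, hg⟩
    exact Subtype.ext (Subgroup.mem_centralizer_iff.mp hg f rfl)
  obtain ⟨⟨r, hr⟩, hgen⟩ := IsFreeGroup.exists_forall_mem_zpowers (Subgroup.centralizer {f})
  have key : ∀ g ∈ Subgroup.centralizer {f}, g ∈ Subgroup.zpowers r := by
    intro g hg
    obtain ⟨k, hk⟩ := hgen ⟨g, hg⟩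
    exact ⟨k, congrArg Subtype.val hk⟩
  refine ⟨r, key f hfZ, fun g hg => key g ?_⟩
  obtain ⟨k, rfl⟩ := key f hfZ
  rw [Subgroup.mem_centralizer_iff]
  rintro _ rfl
  exact (hg.zpow_right k).symm.eq

end Centralizers

section StackCount

theorem Nat.exists_modEq_mem_Ico {p : ℕ} (hp : 0 < p) (a k : ℕ) :
    ∃ k', k' ∈ Finset.Ico a (a + p) ∧ k' ≡ k [MOD p] := by
  induction a with
  | zero => exact ⟨k % p, by simpa using Nat.mod_lt k hp, Nat.mod_modEq k p⟩
  | succ a ih =>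
    obtain ⟨k', hk', h⟩ := ih
    rw [Finset.mem_Ico] at hk'
    by_cases hka : k' = a
    · exact ⟨k' + p, by rw [Finset.mem_Ico]; omega, by simpa using h⟩
    · exact ⟨k', by rw [Finset.mem_Ico]; omega, h⟩

theorem Function.Periodic.eq_of_modEq {Y : Type*} {f : ℕ → Y} {p : ℕ}
    (hf : Function.Periodic f p) {j k : ℕ} (h : j ≡ k [MOD p]) : f j = f k := by
  rw [← hf.map_mod_nat j, h, hf.map_mod_nat]

theorem Nat.exists_not_and_succ {P : ℕ → Prop} {a b : ℕ} (hab : a ≤ b) (ha : ¬ P a) (hb : P b) :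
    ∃ j, a ≤ j ∧ j < b ∧ ¬ P j ∧ P (j + 1) := by
  induction b, hab using Nat.le_induction with
  | base => exact absurd hb ha
  | succ b hab ih =>
    by_cases h : P b
    · obtain ⟨j, h1, h2, h3⟩ := ih h
      exact ⟨j, h1, by omega, h3⟩
    · exact ⟨b, hab, by omega, h, hb⟩

/-- Let a closed path of length `m * ℓ` visit vertices `q k` and edges `E k` with heights
`H`, `K`, where `H` has period `ℓ`. If visits that are highest (lowest) over their vertex are
highest (lowest) over the adjacent edges, and every edge is traversed at least twice, then the path
covers at least `m` more edges than vertices. -/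
theorem ncard_range_add_le_of_stack {V W X : Type*} [LinearOrder X] {m ℓ : ℕ}
    (hℓ : 0 < ℓ) (hm : 0 < m) {q : ℕ → V} {E : ℕ → W} {H K : ℕ → X}
    (hq : Function.Periodic q (m * ℓ)) (hE : Function.Periodic E (m * ℓ))
    (hH : Function.Periodic H ℓ)
    (hinj : ∀ j k, E j = E k → K j = K k → j ≡ k [MOD m * ℓ])
    (htop : ∀ k, (∀ j, q j = q k → H j ≤ H k) → ∀ j, E j = E k → K j ≤ K k)
    (htop' : ∀ k, (∀ j, q j = q (k + 1) → H j ≤ H (k + 1)) → ∀ j, E j = E k → K j ≤ K k)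
    (hbot : ∀ k, (∀ j, q j = q k → H k ≤ H j) → ∀ j, E j = E k → K k ≤ K j)
    (htwice : ∀ k, ∃ j, E j = E k ∧ ¬ j ≡ k [MOD m * ℓ]) :
    (Set.range q).ncard + m ≤ (Set.range E).ncard := by
  classical
  have hNpos : 0 < m * ℓ := Nat.mul_pos hm hℓ
  have hHN : Function.Periodic H (m * ℓ) := hH.nat_mul m
  obtain ⟨a, -, ha⟩ := Finset.exists_max_image (Finset.range ℓ) H ⟨0, by simpa using hℓ⟩
  have hmax : ∀ k, H k ≤ H a := by
    intro k
    rw [← hH.map_mod_nat k]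
    exact ha _ (Finset.mem_range.mpr (Nat.mod_lt k hℓ))
  obtain ⟨c, hc, hc'⟩ := Finset.exists_min_image (Finset.Ico a (a + ℓ)) H
    ⟨a, by rw [Finset.mem_Ico]; omega⟩
  rw [Finset.mem_Ico] at hc
  have hmin : ∀ k, H c ≤ H k := by
    intro k
    obtain ⟨k', hk', hkk⟩ := Nat.exists_modEq_mem_Ico hℓ a k
    rw [← hH.eq_of_modEq hkk]
    exact hc' k' hk'
  have hHr : ∀ k r, H (k + r * ℓ) = H k := fun k r =>
    hH.eq_of_modEq (by simp [Nat.ModEq])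
  set I := Finset.Ico a (a + m * ℓ) with hI
  let TV : ℕ → Prop := fun k => ∀ j, q j = q k → H j ≤ H k
  let TE : ℕ → Prop := fun k => ∀ j, E j = E k → K j ≤ K k
  have hTVa : ∀ r, TV (a + r * ℓ) := fun r j _ => by
    rw [hHr]; exact hmax j
  have hTVc : ∀ r, ¬ TV (c + r * ℓ) := by
    intro r hT
    obtain ⟨j, hj, hj'⟩ := htwice (c + r * ℓ)
    have h1 := htop _ hT j hj
    have h2 := hbot (c + r * ℓ) (fun i _ => by rw [hHr]; exact hmin i) j hj
    exact hj' (hinj _ _ hj (le_antisymm h1 h2))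
  have hstep : ∀ r, ∃ j, a + r * ℓ ≤ j ∧ j < a + (r + 1) * ℓ ∧ ¬ TV j ∧ TV (j + 1) := by
    intro r
    obtain ⟨j, h1, h2, h3⟩ := Nat.exists_not_and_succ (P := TV) (a := c + r * ℓ)
      (b := a + (r + 1) * ℓ) (by rw [add_mul]; omega) (hTVc r) (hTVa (r + 1))
    exact ⟨j, by omega, h2, h3⟩
  choose J hJ1 hJ2 hJ3 hJ4 using hstep
  have hJinj : Function.Injective J := by
    apply StrictMono.injective
    apply strictMono_nat_of_lt_succ
    intro r
    exact (hJ2 r).trans_le (hJ1 (r + 1))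
  have hV : (Set.range q).ncard ≤ (I.filter TV).card := by
    have hsub : Set.range q ⊆ ((I.filter TV).image q : Finset V) := by
      rintro _ ⟨k, rfl⟩
      obtain ⟨k', hk', hkk⟩ := Nat.exists_modEq_mem_Ico hNpos a k
      obtain ⟨t, ht, htmax⟩ := Finset.exists_max_image (I.filter fun j => q j = q k) H
        ⟨k', by rw [Finset.mem_filter]; exact ⟨hk', hq.eq_of_modEq hkk⟩⟩
      rw [Finset.mem_filter] at ht
      rw [Finset.mem_coe, Finset.mem_image]
      refine ⟨t, Finset.mem_filter.mpr ⟨ht.1, fun j hj => ?_⟩, ht.2⟩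
      obtain ⟨j', hj', hjj⟩ := Nat.exists_modEq_mem_Ico hNpos a j
      rw [← hHN.eq_of_modEq hjj]
      exact htmax j' (Finset.mem_filter.mpr ⟨hj', by rw [hq.eq_of_modEq hjj, hj, ht.2]⟩)
    calc (Set.range q).ncard ≤ (((I.filter TV).image q : Finset V) : Set V).ncard :=
          Set.ncard_le_ncard hsub (Finset.finite_toSet _)
      _ = ((I.filter TV).image q).card := Set.ncard_coe_finset _
      _ ≤ _ := Finset.card_image_le
  have hW : (I.filter TE).card ≤ (Set.range E).ncard := by
    have hinjOn : Set.InjOn E (I.filter TE : Finset ℕ) := by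
      intro j hj k hk hjk
      rw [Finset.mem_coe, Finset.mem_filter, hI, Finset.mem_Ico] at hj hk
      have := hinj j k hjk (le_antisymm (hk.2 j hjk) (hj.2 k hjk.symm))
      refine Nat.ModEq.eq_of_abs_lt this ?_
      rw [abs_lt]
      constructor <;> push_cast <;> [skip; skip] <;> zify at hj hk <;> omega
    have hfin : (Set.range E).Finite := by
      refine (((Finset.Ico a (a + m * ℓ)).image E).finite_toSet).subset ?_
      rintro _ ⟨k, rfl⟩
      obtain ⟨k', hk', hkk⟩ := Nat.exists_modEq_mem_Ico hNpos a k
      rw [Finset.mem_coe, Finset.mem_image]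
      exact ⟨k', hk', hE.eq_of_modEq hkk⟩
    calc (I.filter TE).card = ((I.filter TE).image E).card :=
          (Finset.card_image_of_injOn hinjOn).symm
      _ = (((I.filter TE).image E : Finset W) : Set W).ncard := (Set.ncard_coe_finset _).symm
      _ ≤ _ := Set.ncard_le_ncard (by
        intro x hx
        rw [Finset.mem_coe, Finset.mem_image] at hx
        obtain ⟨k, -, rfl⟩ := hx
        exact ⟨k, rfl⟩) hfin
  have hdisj : Disjoint (I.filter TV) ((Finset.range m).image J) := by
    rw [Finset.disjoint_left]
    intro k hk hk'
    rw [Finset.mem_image] at hk'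
    obtain ⟨r, -, rfl⟩ := hk'
    exact hJ3 r (Finset.mem_filter.mp hk).2
  have hsub : I.filter TV ∪ (Finset.range m).image J ⊆ I.filter TE := by
    intro k hk
    rw [Finset.mem_union] at hk
    rcases hk with hk | hk
    · rw [Finset.mem_filter] at hk ⊢
      exact ⟨hk.1, htop k hk.2⟩
    · rw [Finset.mem_image] at hk
      obtain ⟨r, hr, rfl⟩ := hk
      rw [Finset.mem_range] at hr
      refine Finset.mem_filter.mpr ⟨?_, htop' _ (hJ4 r)⟩
      have h1 := hJ1 r
      have h2 := hJ2 r
      have h3 : (r + 1) * ℓ ≤ m * ℓ := Nat.mul_le_mul_right _ hr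
      rw [hI, Finset.mem_Ico]
      exact ⟨by omega, by omega⟩
  have hcard := Finset.card_le_card hsub
  rw [Finset.card_union_of_disjoint hdisj, Finset.card_image_of_injective _ hJinj,
    Finset.card_range] at hcard
  omega

end StackCount

section Cocycles

variable {α Q M : Type*} [MulAction (FreeGroup α) Q] [AddCommGroup M]

/-- The action of the free group on `Q × M` in which the generator `i` moves `(q, s)` to
`(i • q, s + φ (q, i))`. -/
def FreeGroup.skewAction (φ : Q × α → M) : FreeGroup α →* Equiv.Perm (Q × M) :=
  FreeGroup.lift fun i =>
    { toFun := fun p => (FreeGroup.of i • p.1, p.2 + φ (p.1, i))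
      invFun := fun p => ((FreeGroup.of i)⁻¹ • p.1, p.2 - φ ((FreeGroup.of i)⁻¹ • p.1, i))
      left_inv := fun p => by simp
      right_inv := fun p => by simp }

/-- The sum of the weights `φ` along the path that the word `g` traces out from `q`. -/
def FreeGroup.cocycle (φ : Q × α → M) (g : FreeGroup α) (q : Q) : M :=
  (FreeGroup.skewAction φ g (q, 0)).2

namespace FreeGroup

theorem skewAction_apply (φ : Q × α → M) (g : FreeGroup α) (q : Q) (s : M) :
    skewAction φ g (q, s) = (g • q, s + cocycle φ g q) := by
  have key : ∀ h : FreeGroup α,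
      (∀ q s, skewAction φ h (q, s) = (h • q, s + cocycle φ h q)) →
      ∀ q s, skewAction φ h⁻¹ (q, s) = (h⁻¹ • q, s + cocycle φ h⁻¹ q) := by
    intro h ih q s
    have h1 : ∀ s, skewAction φ h⁻¹ (q, s) = (h⁻¹ • q, s - cocycle φ h (h⁻¹ • q)) := by
      intro s
      rw [_root_.map_inv, Equiv.Perm.inv_def, Equiv.symm_apply_eq, ih]
      simp
    rw [cocycle, h1, h1]
    simp [sub_eq_add_neg]
  have hof : ∀ i : α, ∀ q s, skewAction φ (of i) (q, s) = (of i • q, s + cocycle φ (of i) q) := by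
    intro i q s
    simp [skewAction, cocycle]
  induction g using FreeGroup.induction_on generalizing q s with
  | C1 => simp [cocycle]
  | of i => exact hof i q s
  | inv_of i _ => exact key _ (hof i) q s
  | mul g h ihg ihh =>
    have h1 : ∀ s, skewAction φ (g * h) (q, s) =
        ((g * h) • q, s + cocycle φ h q + cocycle φ g (h • q)) := by
      intro s
      rw [_root_.map_mul, Equiv.Perm.mul_apply, ihh, ihg, mul_smul]
    rw [cocycle, h1, h1, zero_add, add_assoc]

@[simp]
theorem cocycle_of (φ : Q × α → M) (i : α) (q : Q) : cocycle φ (of i) q = φ (q, i) := by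
  simp [skewAction, cocycle]

@[simp]
theorem cocycle_one (φ : Q × α → M) (q : Q) : cocycle φ 1 q = 0 := by
  simp [cocycle]

theorem cocycle_mul (φ : Q × α → M) (g h : FreeGroup α) (q : Q) :
    cocycle φ (g * h) q = cocycle φ h q + cocycle φ g (h • q) := by
  rw [cocycle, _root_.map_mul, Equiv.Perm.mul_apply, skewAction_apply φ h, skewAction_apply,
    zero_add]

theorem cocycle_inv (φ : Q × α → M) (g : FreeGroup α) (q : Q) :
    cocycle φ g⁻¹ q = - cocycle φ g (g⁻¹ • q) := by
  have := cocycle_mul φ g g⁻¹ q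
  rw [mul_inv_cancel, cocycle_one] at this
  exact eq_neg_of_add_eq_zero_left this.symm

theorem cocycle_unique {φ : Q × α → M} {κ : FreeGroup α → Q → M}
    (hof : ∀ i q, κ (of i) q = φ (q, i))
    (hmul : ∀ g h q, κ (g * h) q = κ h q + κ g (h • q)) (g : FreeGroup α) (q : Q) :
    κ g q = cocycle φ g q := by
  have hone : ∀ q, κ 1 q = 0 := fun q => by simpa using hmul 1 1 q
  induction g using FreeGroup.induction_on generalizing q with
  | C1 => rw [hone, cocycle_one]
  | of i => rw [hof, cocycle_of]
  | inv_of i _ =>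
    have := hmul (of i) (of i)⁻¹ q
    rw [mul_inv_cancel, hone, hof] at this
    rw [cocycle_inv, cocycle_of, eq_neg_of_add_eq_zero_left this.symm]
  | mul g h ihg ihh => rw [hmul, cocycle_mul, ihg, ihh]

theorem cocycle_add (φ ψ : Q × α → M) (g : FreeGroup α) (q : Q) :
    cocycle (φ + ψ) g q = cocycle φ g q + cocycle ψ g q :=
  (cocycle_unique (κ := fun g q => cocycle φ g q + cocycle ψ g q) (by simp)
    (fun g h q => by simp only [cocycle_mul]; abel) g q).symm

theorem cocycle_smul {R : Type*} [Ring R] [Module R M] (c : R) (φ : Q × α → M) (g : FreeGroup α)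
    (q : Q) : cocycle (c • φ) g q = c • cocycle φ g q :=
  (cocycle_unique (κ := fun g q => c • cocycle φ g q) (by simp)
    (fun g h q => by simp only [cocycle_mul, smul_add]) g q).symm

end FreeGroup

end Cocycles

section RatCharacters

/-- The `ℚ`-vector space of homomorphisms from `G` to `ℚ`. -/
abbrev RatChar (G : Type*) [Group G] := Additive G →+ ℚ

/-- Restriction of rational characters to a subgroup. -/
def RatChar.res {G : Type*} [Group G] (A : Subgroup G) : RatChar G →ₗ[ℚ] RatChar A where
  toFun χ := χ.comp (MonoidHom.toAdditive A.subtype)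
  map_add' _ _ := rfl
  map_smul' _ _ := rfl

theorem RatChar.res_apply {G : Type*} [Group G] (A : Subgroup G) (χ : RatChar G) (a : A) :
    RatChar.res A χ (Additive.ofMul a) = χ (Additive.ofMul (a : G)) := rfl

/-- The rational character with prescribed values on free generators. -/
theorem RatChar.exists_eq_on_generators {G : Type*} [Group G] [IsFreeGroup G]
    (f : IsFreeGroup.Generators G → ℚ) :
    ∃ χ : RatChar G, ∀ i, χ (Additive.ofMul (IsFreeGroup.of i)) = f i :=
  ⟨MonoidHom.toAdditiveLeft (IsFreeGroup.lift fun i => Multiplicative.ofAdd (f i)),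
    fun i => by simp⟩

/-- Evaluation of rational characters on a family of elements. -/
def RatChar.eval {G ι : Type*} [Group G] (v : ι → G) : RatChar G →ₗ[ℚ] (ι → ℚ) where
  toFun χ i := χ (Additive.ofMul (v i))
  map_add' _ _ := rfl
  map_smul' _ _ := rfl

theorem RatChar.eval_of_injective {α : Type*} :
    Function.Injective (RatChar.eval (FreeGroup.of : α → FreeGroup α)) := by
  intro χ ψ h
  have : MonoidHom.toAdditiveLeft.symm χ = MonoidHom.toAdditiveLeft.symm ψ :=
    FreeGroup.ext_hom _ _ fun i => congrFun h i
  exact MonoidHom.toAdditiveLeft.symm.injective this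

instance {α : Type*} [Finite α] : Module.Finite ℚ (RatChar (FreeGroup α)) :=
  Module.Finite.of_injective _ RatChar.eval_of_injective

theorem RatChar.finrank_freeGroup_le {α : Type*} [Fintype α] :
    Module.finrank ℚ (RatChar (FreeGroup α)) ≤ Fintype.card α := by
  simpa using LinearMap.finrank_le_finrank_of_injective
    (RatChar.eval_of_injective (α := α))

end RatCharacters

section EulerCharacteristic

open FreeGroup

variable {α : Type*} (A : Subgroup (FreeGroup α))

/-- The rational character of `A` that sums the weights `φ` along loops at the base vertex of the
coset graph. -/
noncomputable def cosetGraphChar : ((FreeGroup α ⧸ A) × α → ℚ) →ₗ[ℚ] RatChar A where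
  toFun φ :=
    { toFun := fun a => cocycle φ (a.toMul : FreeGroup α) (QuotientGroup.mk (s := A) 1)
      map_zero' := by simp
      map_add' := fun a b => by
        have hb : (b.toMul : FreeGroup α) • (QuotientGroup.mk (s := A) 1) =
            QuotientGroup.mk (s := A) 1 := by
          rw [MulAction.Quotient.smul_mk, QuotientGroup.eq]
          simp
        rw [toMul_add, Subgroup.coe_mul, cocycle_mul, hb, add_comm] }
  map_add' φ ψ := by ext a; exact cocycle_add φ ψ _ _
  map_smul' c φ := by ext a; exact cocycle_smul c φ _ _

theorem cosetGraphChar_apply (φ : (FreeGroup α ⧸ A) × α → ℚ) (a : A) :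
    cosetGraphChar A φ (Additive.ofMul a) =
      cocycle φ (a : FreeGroup α) (QuotientGroup.mk (s := A) 1) := rfl

theorem exists_potential_of_cosetGraphChar_eq_zero {φ : (FreeGroup α ⧸ A) × α → ℚ}
    (h : cosetGraphChar A φ = 0) :
    ∃ f : FreeGroup α ⧸ A → ℚ, ∀ q i, φ (q, i) = f (of i • q) - f q := by
  have hz : ∀ a ∈ A, cocycle φ a (QuotientGroup.mk (s := A) 1) = 0 := fun a ha => by
    rw [← cosetGraphChar_apply A φ ⟨a, ha⟩, h]; rfl
  have hsmul : ∀ g : FreeGroup α, g • (QuotientGroup.mk (s := A) 1) = QuotientGroup.mk g :=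
    fun g => by rw [MulAction.Quotient.smul_mk, smul_eq_mul, mul_one]
  have hwd : ∀ g h : FreeGroup α, QuotientGroup.mk (s := A) g = QuotientGroup.mk h →
      cocycle φ g (QuotientGroup.mk (s := A) 1) = cocycle φ h (QuotientGroup.mk (s := A) 1) := by
    intro g h hgh
    have hA := QuotientGroup.eq.mp hgh
    have h1 := cocycle_mul φ g (g⁻¹ * h) (QuotientGroup.mk (s := A) 1)
    rw [mul_inv_cancel_left, hz _ hA, zero_add, hsmul,
      (QuotientGroup.eq (s := A) (a := g⁻¹ * h) (b := 1)).mpr (by simpa using A.inv_mem hA)] at h1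
    exact h1.symm
  refine ⟨fun q => cocycle φ q.out (QuotientGroup.mk (s := A) 1), fun q i => ?_⟩
  have h1 : of i • q = QuotientGroup.mk (s := A) (of i * q.out) := by
    rw [← smul_eq_mul, ← MulAction.Quotient.smul_mk, QuotientGroup.out_eq']
  have h2 := cocycle_mul φ (of i) q.out (QuotientGroup.mk (s := A) 1)
  rw [hsmul, QuotientGroup.out_eq', cocycle_of] at h2
  dsimp only
  rw [h1, hwd _ (of i * q.out) (QuotientGroup.out_eq' _), h2]
  ring

/-- A finite subgraph of the coset graph of `A` has at most `finrank (RatChar A)` independent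
cycles if every rational character of `A` extends. -/
theorem ncard_edges_add_one_le [Fintype α] (hA : Function.Surjective (RatChar.res A))
    {V : Set (FreeGroup α ⧸ A)} {E : Set ((FreeGroup α ⧸ A) × α)} (hV : V.Finite) (hE : E.Finite)
    (hne : V.Nonempty) (horig : ∀ e ∈ E, e.1 ∈ V) (hterm : ∀ e ∈ E, of e.2 • e.1 ∈ V) :
    E.ncard + 1 ≤ V.ncard + Fintype.card α := by
  classical
  have := hV.fintype
  have := hE.fintype
  have : Module.Finite ℚ (RatChar A) := Module.Finite.of_surjective _ hA
  have hchar : Module.finrank ℚ (RatChar A) ≤ Fintype.card α :=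
    (LinearMap.finrank_le_finrank_of_surjective hA).trans RatChar.finrank_freeGroup_le
  let ext : (E → ℚ) →ₗ[ℚ] ((FreeGroup α ⧸ A) × α → ℚ) :=
    Function.ExtendByZero.linearMap ℚ Subtype.val
  let T : (E → ℚ) →ₗ[ℚ] RatChar A := (cosetGraphChar A).comp ext
  let d : (V → ℚ) →ₗ[ℚ] (E → ℚ) :=
    { toFun := fun f e => f ⟨_, hterm e e.2⟩ - f ⟨_, horig e e.2⟩
      map_add' := fun f g => by ext e; simp only [Pi.add_apply]; ring
      map_smul' := fun c f => by
        ext e; simp only [Pi.smul_apply, smul_eq_mul, RingHom.id_apply]; ring }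
  have hker : LinearMap.ker T ≤ LinearMap.range d := by
    intro φ hφ
    obtain ⟨f, hf⟩ := exists_potential_of_cosetGraphChar_eq_zero A (φ := ext φ) hφ
    refine ⟨fun q => f q, ?_⟩
    ext e
    have h1 : ext φ e = φ e := Subtype.val_injective.extend_apply φ 0 e
    rw [← h1, ← Prod.mk.eta (p := (e : (FreeGroup α ⧸ A) × α)), hf]
    rfl
  have hd : 1 ≤ Module.finrank ℚ (LinearMap.ker d) := by
    rw [Nat.one_le_iff_ne_zero, Ne, Submodule.finrank_eq_zero, Submodule.eq_bot_iff]
    push Not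
    refine ⟨fun _ => 1, by ext e; simp [d], fun h => ?_⟩
    exact one_ne_zero (congrFun h ⟨_, hne.some_mem⟩)
  have h1 := LinearMap.finrank_range_add_finrank_ker T
  have h2 := LinearMap.finrank_range_add_finrank_ker d
  have h3 := Submodule.finrank_mono hker
  have h4 := Submodule.finrank_le (LinearMap.range T)
  rw [Module.finrank_fintype_fun_eq_card] at h1 h2
  rw [Set.ncard_eq_toFinset_card', Set.ncard_eq_toFinset_card', Set.toFinset_card,
    Set.toFinset_card]
  omega

end EulerCharacteristic

section AvoidedEdge

open FreeGroup

variable {α : Type*} {A : Subgroup (FreeGroup α)}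

/-- `AvoidsEdge A e h` says that `h` is spelled by a path that starts at the base vertex of the
coset graph of `A` and does not use the edge `e`. -/
inductive AvoidsEdge (A : Subgroup (FreeGroup α)) (e : (FreeGroup α ⧸ A) × α) :
    FreeGroup α → Prop
  | one : AvoidsEdge A e 1
  | of_mul (h : FreeGroup α) (i : α) : AvoidsEdge A e h → ((h : FreeGroup α ⧸ A), i) ≠ e →
      AvoidsEdge A e (of i * h)
  | inv_mul (h : FreeGroup α) (i : α) : AvoidsEdge A e h →
      ((((of i)⁻¹ * h : FreeGroup α) : FreeGroup α ⧸ A), i) ≠ e → AvoidsEdge A e ((of i)⁻¹ * h)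

/-- The fundamental group of the component of the base vertex in the coset graph without `e`. -/
def avoidingSubgroup (A : Subgroup (FreeGroup α)) (e : (FreeGroup α ⧸ A) × α) :
    Subgroup (FreeGroup α) :=
  Subgroup.closure {g | ∃ h h', AvoidsEdge A e h ∧ AvoidsEdge A e h' ∧
    (h : FreeGroup α ⧸ A) = h' ∧ g = h⁻¹ * h'}

variable {e : (FreeGroup α ⧸ A) × α}

theorem AvoidsEdge.inv_mul_mem {h h' : FreeGroup α} (hh : AvoidsEdge A e h)
    (hh' : AvoidsEdge A e h') (heq : (h : FreeGroup α ⧸ A) = h') :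
    h⁻¹ * h' ∈ avoidingSubgroup A e :=
  Subgroup.subset_closure ⟨h, h', hh, hh', heq, rfl⟩

theorem avoidingSubgroup_le : avoidingSubgroup A e ≤ A := by
  rw [avoidingSubgroup, Subgroup.closure_le]
  rintro _ ⟨h, h', -, -, heq, rfl⟩
  exact QuotientGroup.eq.mp heq

theorem mk_of_mul_congr {a b : FreeGroup α} (x : FreeGroup α) (h : (a : FreeGroup α ⧸ A) = b) :
    ((x * a : FreeGroup α) : FreeGroup α ⧸ A) = ((x * b : FreeGroup α) : FreeGroup α ⧸ A) := by
  rw [QuotientGroup.eq] at h ⊢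
  simpa [mul_assoc] using h

variable {p p' c : FreeGroup α} {i : α}

theorem exists_avoidsEdge_mul (hp : AvoidsEdge A (↑p, i) p) (hp' : AvoidsEdge A (↑p, i) p')
    (hc : c ∈ A) (hpc : p' * c = of i * p) (g : FreeGroup α) :
    ∃ h k, AvoidsEdge A (↑p, i) h ∧ k ∈ Subgroup.zpowers c ⊔ avoidingSubgroup A (↑p, i) ∧
      g = h * k := by
  set D := Subgroup.zpowers c ⊔ avoidingSubgroup A (↑p, i) with hD
  have hcD : c ∈ D := (le_sup_left : _ ≤ D) (Subgroup.mem_zpowers c)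
  have hAD : avoidingSubgroup A (↑p, i) ≤ D := le_sup_right
  let Good : FreeGroup α → Prop := fun g => ∃ h k, AvoidsEdge A (↑p, i) h ∧ k ∈ D ∧ g = h * k
  have hof : ∀ j g, Good g → Good (of j * g) := by
    rintro j _ ⟨h, k, hh, hk, rfl⟩
    by_cases hj : ((h : FreeGroup α ⧸ A), j) = (↑p, i)
    · obtain ⟨h1, rfl⟩ := Prod.mk.inj hj
      refine ⟨p', c * ((p⁻¹ * h) * k), hp',
        D.mul_mem hcD (D.mul_mem (hAD (hp.inv_mul_mem hh h1.symm)) hk), ?_⟩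
      rw [← mul_assoc p', hpc]
      group
    · exact ⟨of j * h, k, .of_mul h j hh hj, hk, (mul_assoc _ _ _).symm⟩
  have hinv : ∀ j g, Good g → Good ((of j)⁻¹ * g) := by
    rintro j _ ⟨h, k, hh, hk, rfl⟩
    by_cases hj : ((((of j)⁻¹ * h : FreeGroup α) : FreeGroup α ⧸ A), j) = (↑p, i)
    · obtain ⟨h1, rfl⟩ := Prod.mk.inj hj
      have h2 : (p' : FreeGroup α ⧸ A) = h := by
        have h3 := mk_of_mul_congr (of j) h1
        rw [mul_inv_cancel_left, ← hpc] at h3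
        rw [h3, QuotientGroup.eq]
        simpa using hc
      refine ⟨p, c⁻¹ * ((p'⁻¹ * h) * k), hp,
        D.mul_mem (D.inv_mem hcD) (D.mul_mem (hAD (hp'.inv_mul_mem hh h2)) hk), ?_⟩
      have h4 : p * c⁻¹ = (of j)⁻¹ * p' := by
        rw [mul_inv_eq_iff_eq_mul, mul_assoc, hpc, inv_mul_cancel_left]
      rw [← mul_assoc p, h4]
      group
    · exact ⟨(of j)⁻¹ * h, k, .inv_mul h j hh hj, hk, (mul_assoc _ _ _).symm⟩
  have hall : ∀ g g', Good g' → Good (g * g') := by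
    intro g
    induction g using FreeGroup.induction_on with
    | C1 => intro g' h; rwa [one_mul]
    | of j => exact hof j
    | inv_of j _ => exact hinv j
    | mul a b iha ihb => intro g' h; rw [mul_assoc]; exact iha _ (ihb _ h)
  have := hall g 1 ⟨1, 1, .one, D.one_mem, (one_mul 1).symm⟩
  rwa [mul_one] at this

theorem zpowers_sup_avoidingSubgroup (hp : AvoidsEdge A (↑p, i) p)
    (hp' : AvoidsEdge A (↑p, i) p') (hc : c ∈ A) (hpc : p' * c = of i * p) :
    Subgroup.zpowers c ⊔ avoidingSubgroup A (↑p, i) = A := by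
  have hle : Subgroup.zpowers c ⊔ avoidingSubgroup A (↑p, i) ≤ A :=
    sup_le (Subgroup.zpowers_le.mpr hc) avoidingSubgroup_le
  refine le_antisymm hle fun g hg => ?_
  obtain ⟨h, k, hh, hk, rfl⟩ := exists_avoidsEdge_mul hp hp' hc hpc g
  have hhA : h ∈ A := (Subgroup.mul_mem_cancel_right A (hle hk)).mp hg
  refine Subgroup.mul_mem _ (Subgroup.mem_sup_right ?_) hk
  have := AvoidsEdge.inv_mul_mem (AvoidsEdge.one (A := A) (e := (↑p, i))) hh
    (QuotientGroup.eq.mpr (by simpa using hhA))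
  simpa using this

theorem exists_avoidsEdge_rep (hp : AvoidsEdge A (↑p, i) p) (hp' : AvoidsEdge A (↑p, i) p')
    (hc : c ∈ A) (hpc : p' * c = of i * p) (q : FreeGroup α ⧸ A) :
    ∃ h : FreeGroup α, AvoidsEdge A (↑p, i) h ∧ (h : FreeGroup α ⧸ A) = q := by
  obtain ⟨g, rfl⟩ := QuotientGroup.mk_surjective q
  obtain ⟨h, k, hh, hk, rfl⟩ := exists_avoidsEdge_mul hp hp' hc hpc g
  rw [zpowers_sup_avoidingSubgroup hp hp' hc hpc] at hk
  exact ⟨h, hh, QuotientGroup.eq.mpr (by simpa using hk)⟩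

theorem exists_ratChar_of_avoidingSubgroup (hp : AvoidsEdge A (↑p, i) p)
    (hp' : AvoidsEdge A (↑p, i) p') (hc : c ∈ A) (hpc : p' * c = of i * p)
    (χ : RatChar (avoidingSubgroup A (↑p, i))) (v : ℚ) :
    ∃ ψ : RatChar A, ψ (Additive.ofMul ⟨c, hc⟩) = v ∧
      ∀ g : avoidingSubgroup A (↑p, i),
        ψ (Additive.ofMul ⟨g, avoidingSubgroup_le g.2⟩) = χ (Additive.ofMul g) := by
  classical
  choose rep hrep hrepq using exists_avoidsEdge_rep hp hp' hc hpc
  let χ₀ : FreeGroup α → ℚ := fun g =>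
    if hg : g ∈ avoidingSubgroup A (↑p, i) then χ (Additive.ofMul ⟨g, hg⟩) else 0
  have hχ₀ : ∀ g : avoidingSubgroup A (↑p, i), χ₀ g = χ (Additive.ofMul g) := fun g => by simp [χ₀]
  have hmul : ∀ {g h k : FreeGroup α}, g ∈ avoidingSubgroup A (↑p, i) →
      h ∈ avoidingSubgroup A (↑p, i) → g * h = k → χ₀ k = χ₀ g + χ₀ h := by
    rintro g h _ hg hh rfl
    have h1 := hχ₀ ⟨g * h, Subgroup.mul_mem _ hg hh⟩
    have h2 := hχ₀ ⟨g, hg⟩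
    have h3 := hχ₀ ⟨h, hh⟩
    simp only at h1 h2 h3
    rw [h1, h2, h3, ← map_add]
    rfl
  let t : ℚ := v + χ₀ ((rep p')⁻¹ * p') - χ₀ ((rep p)⁻¹ * p)
  let φ : (FreeGroup α ⧸ A) × α → ℚ := fun d =>
    if d = (↑p, i) then t else χ₀ ((rep (of d.2 • d.1))⁻¹ * (of d.2 * rep d.1))
  have hsmul : ∀ g h : FreeGroup α,
      g • (h : FreeGroup α ⧸ A) = ((g * h : FreeGroup α) : FreeGroup α ⧸ A) := fun _ _ => rfl
  have hbase : ∀ h : FreeGroup α, h • ((1 : FreeGroup α) : FreeGroup α ⧸ A) = h := fun h => by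
    rw [hsmul, mul_one]
  have hφ : ∀ (h : FreeGroup α) (j : α), ((h : FreeGroup α ⧸ A), j) ≠ (↑p, i) →
      φ (h, j) = χ₀ ((rep (of j * h : FreeGroup α))⁻¹ * (of j * rep h)) := fun h j hj => by
    simp only [φ, if_neg hj, hsmul]
  have hmem : ∀ h : FreeGroup α, AvoidsEdge A (↑p, i) h →
      (rep h)⁻¹ * h ∈ avoidingSubgroup A (↑p, i) := fun h hh =>
    (hrep h).inv_mul_mem hh (hrepq h)
  have hmem' : ∀ (h : FreeGroup α) (j : α), ((h : FreeGroup α ⧸ A), j) ≠ (↑p, i) →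
      (rep (of j * h : FreeGroup α))⁻¹ * (of j * rep h) ∈ avoidingSubgroup A (↑p, i) :=
    fun h j hj =>
    (hrep _).inv_mul_mem (.of_mul _ _ (hrep _) (by rwa [hrepq]))
      (by rw [hrepq, ← hsmul, ← hsmul, hrepq])
  have key : ∀ h, AvoidsEdge A (↑p, i) h → cocycle φ h ((1 : FreeGroup α) : FreeGroup α ⧸ A) =
      χ₀ ((rep h)⁻¹ * h) - χ₀ ((rep (1 : FreeGroup α))⁻¹ * 1) := by
    intro h hh
    induction hh with
    | one => rw [cocycle_one, sub_self]
    | of_mul h j hh hj ih =>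
      rw [cocycle_mul, ih, hbase, cocycle_of, hφ h j hj,
        hmul (hmem' h j hj) (hmem h hh) (k := (rep (of j * h : FreeGroup α))⁻¹ * (of j * h))
          (by group)]
      ring
    | inv_mul h j hh hj ih =>
      have h1 := hmem' _ j hj
      have h2 := hφ _ j hj
      rw [mul_inv_cancel_left] at h1 h2
      rw [cocycle_mul, ih, hbase, cocycle_inv, hsmul, cocycle_of, h2,
        hmul h1 (hmem _ (.inv_mul h j hh hj)) (k := (rep h)⁻¹ * h) (by group)]
      ring
  have hA : ∀ a ∈ A, a • ((1 : FreeGroup α) : FreeGroup α ⧸ A) = (1 : FreeGroup α) := by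
    intro a ha
    rw [hsmul, QuotientGroup.eq]
    simpa using ha
  refine ⟨cosetGraphChar A φ, ?_, ?_⟩
  · rw [cosetGraphChar_apply]
    have h1 := cocycle_mul φ p' c ((1 : FreeGroup α) : FreeGroup α ⧸ A)
    rw [hpc, cocycle_mul, hA c hc, key p hp, key p' hp', hbase, cocycle_of] at h1
    have h2 : φ (↑p, i) = t := if_pos rfl
    rw [h2] at h1
    simp only [t] at h1
    change cocycle φ c ((1 : FreeGroup α) : FreeGroup α ⧸ A) = v
    linarith
  · rintro ⟨g, hg⟩
    rw [cosetGraphChar_apply, ← hχ₀]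
    change cocycle φ g ((1 : FreeGroup α) : FreeGroup α ⧸ A) = χ₀ g
    clear_value χ₀
    induction hg using Subgroup.closure_induction with
    | mem g hg =>
      obtain ⟨h, h', hh, hh', heq, rfl⟩ := hg
      have hgN := hh.inv_mul_mem hh' heq
      have h1 := cocycle_mul φ h (h⁻¹ * h') ((1 : FreeGroup α) : FreeGroup α ⧸ A)
      rw [hA _ (avoidingSubgroup_le hgN), mul_inv_cancel_left, key h hh, key h' hh', ← heq,
        hmul (hmem h hh) hgN (k := (rep h)⁻¹ * h') (by group)] at h1
      linarith
    | one =>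
      rw [cocycle_one]
      linarith [hmul (Subgroup.one_mem _) (Subgroup.one_mem _) (mul_one 1)]
    | mul a b ha hb iha ihb =>
      rw [cocycle_mul, hA b (avoidingSubgroup_le hb), iha, ihb, hmul ha hb rfl, add_comm]
    | inv a ha iha =>
      rw [cocycle_inv, hA _ (A.inv_mem (avoidingSubgroup_le ha)), iha]
      linarith [hmul (Subgroup.one_mem _) (Subgroup.one_mem _) (mul_one 1),
        hmul ha (Subgroup.inv_mem _ ha) (mul_inv_cancel a)]

end AvoidedEdge

theorem exists_eq_closure_pair_of_avoidsEdge {A : Subgroup (FreeGroup (Fin 2))}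
    (hA : Function.Surjective (RatChar.res A)) {p p' c : FreeGroup (Fin 2)} {i : Fin 2}
    (hp : AvoidsEdge A (↑p, i) p) (hp' : AvoidsEdge A (↑p, i) p') (hc : c ∈ A)
    (hpc : p' * c = FreeGroup.of i * p) : ∃ y, A = Subgroup.closure {c, y} := by
  classical
  set N := avoidingSubgroup A (↑p, i)
  have hfin : Module.Finite ℚ (RatChar A) := Module.Finite.of_surjective _ hA
  have hrank : Module.finrank ℚ (RatChar A) ≤ 2 :=
    (LinearMap.finrank_le_finrank_of_surjective hA).trans RatChar.finrank_freeGroup_le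
  have hsub : Subsingleton (IsFreeGroup.Generators N) := by
    by_contra hns
    obtain ⟨a, b, hab⟩ := not_subsingleton_iff_nontrivial.mp hns
    let incl : N → A := fun g => ⟨g, avoidingSubgroup_le g.2⟩
    have hsurj : Function.Surjective (RatChar.eval
        ![incl (IsFreeGroup.of a), incl (IsFreeGroup.of b), (⟨c, hc⟩ : A)]) := by
      intro v
      obtain ⟨χ, hχ⟩ := RatChar.exists_eq_on_generators (G := N)
        (fun g => if g = a then v 0 else v 1)
      obtain ⟨ψ, hψc, hψ⟩ := exists_ratChar_of_avoidingSubgroup hp hp' hc hpc χ (v 2)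
      refine ⟨ψ, ?_⟩
      ext k
      fin_cases k
      · exact (hψ _).trans ((hχ a).trans (if_pos rfl))
      · exact (hψ _).trans ((hχ b).trans (if_neg hab.symm))
      · exact hψc
    have := LinearMap.finrank_le_finrank_of_surjective hsurj
    rw [Module.finrank_fin_fun] at this
    omega
  obtain ⟨y, hy⟩ := IsFreeGroup.exists_forall_mem_zpowers N
  refine ⟨y, ?_⟩
  have hNy : N = Subgroup.zpowers (y : FreeGroup (Fin 2)) := by
    refine le_antisymm (fun g hg => ?_) (Subgroup.zpowers_le.mpr y.2)
    obtain ⟨k, hk⟩ := hy ⟨g, hg⟩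
    exact ⟨k, congrArg Subtype.val hk⟩
  calc A = Subgroup.zpowers c ⊔ N := (zpowers_sup_avoidingSubgroup hp hp' hc hpc).symm
    _ = Subgroup.zpowers c ⊔ Subgroup.zpowers (y : FreeGroup (Fin 2)) := congrArg _ hNy
    _ = Subgroup.closure {c, (y : FreeGroup (Fin 2))} := by
      rw [Subgroup.zpowers_eq_closure, Subgroup.zpowers_eq_closure, ← Subgroup.closure_union,
        Set.singleton_union]

section ReducedPath

open FreeGroup

variable {α : Type*}

/-- The product of the first `k` letters of `u`, later letters being multiplied on the left. -/
def pathProd (u : ℕ → α × Bool) : ℕ → FreeGroup α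
  | 0 => 1
  | k + 1 => FreeGroup.mk [u k] * pathProd u k

theorem pathProd_succ (u : ℕ → α × Bool) (k : ℕ) :
    pathProd u (k + 1) = FreeGroup.mk [u k] * pathProd u k := rfl

theorem pathProd_add_period {u : ℕ → α × Bool} {ℓ : ℕ} (hu : Function.Periodic u ℓ) (k : ℕ) :
    pathProd u (k + ℓ) = pathProd u k * pathProd u ℓ := by
  induction k with
  | zero => rw [zero_add, pathProd, one_mul]
  | succ k ih => rw [add_right_comm, pathProd_succ, ih, pathProd_succ, hu k, mul_assoc]

theorem pathProd_add_mul_period {u : ℕ → α × Bool} {ℓ : ℕ} (hu : Function.Periodic u ℓ)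
    (k n : ℕ) : pathProd u (k + n * ℓ) = pathProd u k * pathProd u ℓ ^ n := by
  induction n with
  | zero => simp
  | succ n ih =>
    rw [add_mul, one_mul, ← add_assoc, pathProd_add_period hu, ih, pow_succ, mul_assoc]

theorem pathProd_injective {u : ℕ → α × Bool}
    (hred : ∀ k, (u (k + 1)).1 = (u k).1 → (u (k + 1)).2 = (u k).2) :
    Function.Injective (pathProd u) := by
  have key : ∀ j d, ∃ W : List (α × Bool), FreeGroup.IsReduced W ∧ W.length = d ∧
      (∀ a ∈ W.head?, a = u (j + d - 1)) ∧ pathProd u (j + d) = FreeGroup.mk W * pathProd u j := by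
    intro j d
    induction d with
    | zero => exact ⟨[], FreeGroup.IsReduced.nil, rfl, by simp, by simp [← one_eq_mk]⟩
    | succ d ih =>
      obtain ⟨W, h1, h2, h3, h4⟩ := ih
      refine ⟨u (j + d) :: W, ?_, by simp [h2], by simp [← add_assoc], ?_⟩
      · rw [FreeGroup.IsReduced, List.isChain_cons]
        refine ⟨fun b hb => ?_, h1⟩
        have hd : d ≠ 0 := by
          rintro rfl
          rw [List.length_eq_zero_iff] at h2
          simp [h2] at hb
        obtain ⟨d, rfl⟩ := Nat.exists_eq_succ_of_ne_zero hd
        rw [h3 b hb]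
        exact hred (j + d)
      · rw [← add_assoc, pathProd_succ, h4, ← mul_assoc, mul_mk, List.singleton_append]
  have hlt : ∀ j d, pathProd u (j + d) = pathProd u j → d = 0 := by
    intro j d h
    obtain ⟨W, h1, h2, -, h4⟩ := key j d
    rw [h4, mul_eq_right] at h
    classical
    rw [← h2, ← FreeGroup.IsReduced.reduce_eq h1, ← toWord_mk, h, toWord_one, List.length_nil]
  intro j k h
  rcases le_total j k with hjk | hjk
  · obtain ⟨d, rfl⟩ := Nat.exists_eq_add_of_le hjk
    rw [hlt j d h.symm, add_zero]
  · obtain ⟨d, rfl⟩ := Nat.exists_eq_add_of_le hjk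
    rw [hlt k d h, add_zero]

theorem exists_conj_eq_pathProd {f : FreeGroup α} (hf : f ≠ 1) :
    ∃ (g : FreeGroup α) (u : ℕ → α × Bool) (ℓ : ℕ), 0 < ℓ ∧ Function.Periodic u ℓ ∧
      (∀ k, (u (k + 1)).1 = (u k).1 → (u (k + 1)).2 = (u k).2) ∧
      g * f * g⁻¹ = pathProd u ℓ := by
  classical
  set L := reduceCyclically f.toWord with hL
  have hcyc : IsCyclicallyReduced L := reduceCyclically.isCyclicallyReduced isReduced_toWord
  set c := reduceCyclically.conjugator f.toWord with hc
  have hconj : f = FreeGroup.mk c * FreeGroup.mk L * (FreeGroup.mk c)⁻¹ := by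
    conv_lhs => rw [← FreeGroup.mk_toWord (x := f),
      ← reduceCyclically.conj_conjugator_reduceCyclically f.toWord]
    rw [inv_mk, mul_mk, mul_mk]
  have hne : L ≠ [] := by
    intro h
    rw [h, ← one_eq_mk, mul_one, mul_inv_cancel] at hconj
    exact hf hconj
  have hpos : 0 < L.reverse.length := by
    rw [List.length_reverse]
    exact List.length_pos_iff.mpr hne
  have hlt : ∀ k, k % L.reverse.length < L.reverse.length := fun k => Nat.mod_lt k hpos
  let u : ℕ → α × Bool := fun k => L.reverse[k % L.reverse.length]'(hlt k)
  have hu : Function.Periodic u L.reverse.length := fun k => by simp [u]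
  have hprod : ∀ k ≤ L.reverse.length,
      pathProd u k = FreeGroup.mk (L.reverse.take k).reverse := by
    intro k hk
    induction k with
    | zero => simp [pathProd, ← one_eq_mk]
    | succ k ih =>
      have hk' : k < L.reverse.length := hk
      rw [pathProd_succ, ih hk'.le, mul_mk, List.take_succ_eq_append_getElem hk',
        List.reverse_append]
      simp [u, Nat.mod_eq_of_lt (by simpa using hk' : k < L.length)]
  refine ⟨(FreeGroup.mk c)⁻¹, u, L.reverse.length, hpos, hu, ?_, ?_⟩
  · intro k
    have hrev : L.reverse.IsChain fun a b => a.1 = b.1 → a.2 = b.2 := by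
      rw [List.isChain_reverse]
      exact hcyc.1.imp fun a b hab h => (hab h.symm).symm
    rcases Nat.lt_or_ge (k % L.reverse.length + 1) L.reverse.length with h | h
    · have h1 : (k + 1) % L.reverse.length = k % L.reverse.length + 1 := by
        rw [Nat.add_mod, Nat.mod_eq_of_lt (by omega : 1 < L.reverse.length), Nat.mod_eq_of_lt h]
      have h2 := List.isChain_iff_getElem.mp hrev _ h
      simp only [u, h1]
      exact fun h3 => (h2 h3.symm).symm
    · have h0 : k % L.reverse.length = L.reverse.length - 1 := by have := hlt k; omega
      have h1 : (k + 1) % L.reverse.length = 0 := by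
        rw [← Nat.mod_add_mod, h0, Nat.sub_add_cancel hpos, Nat.mod_self]
      simp only [u, h0, h1]
      refine hcyc.2 _ ?_ _ ?_
      · rw [← List.head?_reverse, List.head?_eq_getElem?, List.getElem?_eq_getElem hpos]
        rfl
      · rw [← List.getLast?_reverse, List.getLast?_eq_getElem?,
          List.getElem?_eq_getElem (by omega)]
        rfl
  · rw [hprod _ le_rfl, List.take_length, List.reverse_reverse]
    conv_lhs => rw [hconj]
    group

end ReducedPath

section Stacking

open FreeGroup

variable {α : Type*} {A : Subgroup (FreeGroup α)}

theorem avoidsEdge_mk_mul_iff {e : (FreeGroup α ⧸ A) × α} {a : α × Bool} {g : FreeGroup α}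
    (h : (((if a.2 then g else FreeGroup.mk [a] * g : FreeGroup α) : FreeGroup α ⧸ A), a.1) ≠ e) :
    AvoidsEdge A e (FreeGroup.mk [a] * g) ↔ AvoidsEdge A e g := by
  obtain ⟨i, b⟩ := a
  cases b with
  | true =>
    replace h : ((g : FreeGroup α ⧸ A), i) ≠ e := h
    change AvoidsEdge A e (of i * g) ↔ _
    refine ⟨fun hg => ?_, fun hg => .of_mul g i hg h⟩
    have := AvoidsEdge.inv_mul _ i hg (by rwa [inv_mul_cancel_left])
    rwa [inv_mul_cancel_left] at this
  | false =>
    replace h : ((((of i)⁻¹ * g : FreeGroup α) : FreeGroup α ⧸ A), i) ≠ e := h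
    change AvoidsEdge A e ((of i)⁻¹ * g) ↔ _
    refine ⟨fun hg => ?_, fun hg => .inv_mul g i hg h⟩
    have := AvoidsEdge.of_mul _ i hg h
    rwa [mul_inv_cancel_left] at this

theorem Function.Periodic.finite_range_nat {Y : Type*} {f : ℕ → Y} {n : ℕ} (hn : 0 < n)
    (hf : Function.Periodic f n) : (Set.range f).Finite := by
  refine ((Set.finite_Iio n).image f).subset ?_
  rintro _ ⟨k, rfl⟩
  exact ⟨k % n, Nat.mod_lt k hn, hf.map_mod_nat k⟩

/-- The index of the initial vertex of the edge traversed at time `k`. -/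
def pathOrigin (u : ℕ → α × Bool) (k : ℕ) : ℕ := if (u k).2 then k else k + 1

/-- The index of the terminal vertex of the edge traversed at time `k`. -/
def pathTerminus (u : ℕ → α × Bool) (k : ℕ) : ℕ := if (u k).2 then k + 1 else k

theorem pathProd_pathTerminus (u : ℕ → α × Bool) (k : ℕ) :
    pathProd u (pathTerminus u k) = of (u k).1 * pathProd u (pathOrigin u k) := by
  unfold pathTerminus pathOrigin
  rcases h : u k with ⟨i, b⟩
  cases b
  · have : pathProd u (k + 1) = (of i)⁻¹ * pathProd u k := by
      rw [pathProd_succ, h]; rfl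
    simp [this]
  · have : pathProd u (k + 1) = of i * pathProd u k := by
      rw [pathProd_succ, h]; rfl
    simp [this]

/-- The edge of the coset graph of `A` traversed at time `k`. -/
def pathEdge (A : Subgroup (FreeGroup α)) (u : ℕ → α × Bool) (k : ℕ) : (FreeGroup α ⧸ A) × α :=
  (pathProd u (pathOrigin u k), (u k).1)

variable {u : ℕ → α × Bool} {ℓ m : ℕ}

theorem modEq_of_coset_eq_of_conj_eq (hu : Function.Periodic u ℓ)
    (hred : ∀ k, (u (k + 1)).1 = (u k).1 → (u (k + 1)).2 = (u k).2)
    (hcent : ∀ g, Commute g (pathProd u ℓ) → g ∈ Subgroup.zpowers (pathProd u ℓ))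
    (hmin : ∀ z : ℤ, pathProd u ℓ ^ z ∈ A → (m : ℤ) ∣ z) {j k : ℕ}
    (hq : (pathProd u j : FreeGroup α ⧸ A) = pathProd u k)
    (hH : pathProd u j * pathProd u ℓ * (pathProd u j)⁻¹ =
      pathProd u k * pathProd u ℓ * (pathProd u k)⁻¹) : j ≡ k [MOD m * ℓ] := by
  have hA := QuotientGroup.eq.mp hq
  have hcomm : Commute ((pathProd u j)⁻¹ * pathProd u k) (pathProd u ℓ) := by
    rw [mul_inv_eq_iff_eq_mul] at hH
    rw [Commute, SemiconjBy, ← mul_right_inj (pathProd u j), ← mul_left_inj (pathProd u k)⁻¹]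
    calc _ = pathProd u k * pathProd u ℓ * (pathProd u k)⁻¹ := by group
      _ = _ := by rw [← mul_assoc (pathProd u j), hH]; group
  obtain ⟨z, hz⟩ := hcent _ hcomm
  simp only at hz
  rw [← hz] at hA
  obtain ⟨z, rfl⟩ := hmin z hA
  have hper : ∀ j n : ℕ, j ≡ j + (m * n) * ℓ [MOD m * ℓ] := fun j n => by
    simp [Nat.ModEq, mul_right_comm m n ℓ]
  obtain ⟨n, rfl | rfl⟩ := z.eq_nat_or_neg
  · have h1 : k = j + (m * n) * ℓ := by
      apply pathProd_injective hred
      rw [pathProd_add_mul_period hu, ← zpow_natCast, Nat.cast_mul, hz, mul_inv_cancel_left]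
    rw [h1]
    exact hper j n
  · have h1 : j = k + (m * n) * ℓ := by
      apply pathProd_injective hred
      rw [pathProd_add_mul_period hu, ← zpow_natCast, Nat.cast_mul, ← inv_inj, mul_inv_rev,
        ← zpow_neg, ← mul_neg, hz, mul_assoc, mul_inv_cancel, mul_one]
    rw [h1]
    exact (hper k n).symm

theorem modEq_of_pathEdge_eq (hu : Function.Periodic u ℓ)
    (hred : ∀ k, (u (k + 1)).1 = (u k).1 → (u (k + 1)).2 = (u k).2)
    (hcent : ∀ g, Commute g (pathProd u ℓ) → g ∈ Subgroup.zpowers (pathProd u ℓ))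
    (hmin : ∀ z : ℤ, pathProd u ℓ ^ z ∈ A → (m : ℤ) ∣ z) {j k : ℕ}
    (hE : pathEdge A u j = pathEdge A u k)
    (hH : pathProd u (pathOrigin u j) * pathProd u ℓ * (pathProd u (pathOrigin u j))⁻¹ =
      pathProd u (pathOrigin u k) * pathProd u ℓ * (pathProd u (pathOrigin u k))⁻¹) :
    j ≡ k [MOD m * ℓ] := by
  obtain ⟨hq, hi⟩ := Prod.mk.inj hE
  have huN : Function.Periodic u (m * ℓ) := hu.nat_mul m
  have h := modEq_of_coset_eq_of_conj_eq hu hred hcent hmin hq hH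
  have hopp : ∀ {j k}, (u j).1 = (u k).1 → (u j).2 = true → (u k).2 = false →
      ¬ j ≡ k + 1 [MOD m * ℓ] := by
    intro j k h1 h2 h3 h4
    have h5 := huN.eq_of_modEq h4
    have h6 := hred k (by rw [← h5, h1])
    rw [← h5, h2, h3] at h6
    exact Bool.noConfusion h6
  unfold pathOrigin at h
  cases hj : (u j).2 <;> cases hk : (u k).2 <;> simp only [hj, hk] at h
  · exact Nat.ModEq.add_right_cancel' 1 h
  · exact absurd h.symm (hopp hi.symm hk hj)
  · exact absurd h (hopp hi hj hk)
  · exact h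

theorem forall_rel_pathEdge {rel : FreeGroup α → FreeGroup α → Prop}
    (hrel : ∀ g a b, rel a b → rel (g * a * g⁻¹) (g * b * g⁻¹)) (r : FreeGroup α) {p k : ℕ}
    (hp : p = pathOrigin u k ∨ p = pathTerminus u k)
    (h : ∀ j, (pathProd u j : FreeGroup α ⧸ A) = pathProd u p →
      rel (pathProd u j * r * (pathProd u j)⁻¹) (pathProd u p * r * (pathProd u p)⁻¹)) {j : ℕ}
    (hE : pathEdge A u j = pathEdge A u k) :
    rel (pathProd u (pathOrigin u j) * r * (pathProd u (pathOrigin u j))⁻¹)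
      (pathProd u (pathOrigin u k) * r * (pathProd u (pathOrigin u k))⁻¹) := by
  obtain ⟨hq, hi⟩ := Prod.mk.inj hE
  rcases hp with rfl | rfl
  · exact h _ hq
  · have h1 := h (pathTerminus u j) (by
      rw [pathProd_pathTerminus, pathProd_pathTerminus, hi]
      exact mk_of_mul_congr _ hq)
    rw [pathProd_pathTerminus, pathProd_pathTerminus, hi] at h1
    have h2 := hrel (of (u k).1)⁻¹ _ _ h1
    convert h2 using 1 <;> group

theorem origin_or_terminus (u : ℕ → α × Bool) (k : ℕ) :
    (k = pathOrigin u k ∨ k = pathTerminus u k) ∧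
      (k + 1 = pathOrigin u k ∨ k + 1 = pathTerminus u k) := by
  unfold pathOrigin pathTerminus
  cases (u k).2 <;> simp

theorem pathEdge_periodic (hu : Function.Periodic u ℓ) (hmA : pathProd u ℓ ^ m ∈ A) :
    Function.Periodic (fun k => (pathProd u k : FreeGroup α ⧸ A)) (m * ℓ) ∧
      Function.Periodic (pathEdge A u) (m * ℓ) := by
  have h1 : Function.Periodic (fun k => (pathProd u k : FreeGroup α ⧸ A)) (m * ℓ) := fun k => by
    simp only [pathProd_add_mul_period hu]
    rw [QuotientGroup.eq, mul_inv_rev, mul_assoc, inv_mul_cancel, mul_one]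
    exact A.inv_mem hmA
  refine ⟨h1, fun k => ?_⟩
  have huk := hu.nat_mul m k
  simp only [Nat.cast_id] at huk
  have h2 : pathOrigin u (k + m * ℓ) = pathOrigin u k + m * ℓ := by
    unfold pathOrigin
    rw [huk]
    split_ifs <;> omega
  unfold pathEdge
  rw [h2, huk]
  exact congrArg (·, (u k).1) (h1 _)

/-- A closed path in the coset graph of `A` representing an element that is an `m`-th power in
the free group with `m ≥ 2` uses some edge exactly once. -/
theorem exists_pathEdge_traversed_once {A : Subgroup (FreeGroup (Fin 2))}
    {u : ℕ → Fin 2 × Bool} (hA : Function.Surjective (RatChar.res A)) (hℓ : 0 < ℓ) (hm : 2 ≤ m)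
    (hu : Function.Periodic u ℓ)
    (hred : ∀ k, (u (k + 1)).1 = (u k).1 → (u (k + 1)).2 = (u k).2)
    (hcent : ∀ g, Commute g (pathProd u ℓ) → g ∈ Subgroup.zpowers (pathProd u ℓ))
    (hmA : pathProd u ℓ ^ m ∈ A) (hmin : ∀ z : ℤ, pathProd u ℓ ^ z ∈ A → (m : ℤ) ∣ z) :
    ∃ k, ∀ j, pathEdge A u j = pathEdge A u k → j ≡ k [MOD m * ℓ] := by
  by_contra! htwice
  obtain ⟨ord, hconj⟩ := exists_conj_invariant_linearOrder
  obtain ⟨hq, hE⟩ := pathEdge_periodic hu hmA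
  have hN : 0 < m * ℓ := Nat.mul_pos (by omega) hℓ
  have hcount := ncard_range_add_le_of_stack (m := m) (ℓ := ℓ)
    (q := fun k => (pathProd u k : FreeGroup (Fin 2) ⧸ A)) (E := pathEdge A u)
    (H := fun k => pathProd u k * pathProd u ℓ * (pathProd u k)⁻¹)
    (K := fun k => pathProd u (pathOrigin u k) * pathProd u ℓ * (pathProd u (pathOrigin u k))⁻¹)
    hℓ (by omega) hq hE (fun k => by simp only [pathProd_add_period hu]; group)
    (fun j k => modEq_of_pathEdge_eq hu hred hcent hmin)
    (fun k h j => forall_rel_pathEdge (rel := (· ≤ ·)) hconj _ (origin_or_terminus u k).1 h)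
    (fun k h j => forall_rel_pathEdge (rel := (· ≤ ·)) hconj _ (origin_or_terminus u k).2 h)
    (fun k h j => forall_rel_pathEdge (rel := (· ≥ ·)) (fun g a b => hconj g b a) _
      (origin_or_terminus u k).1 h) htwice
  have heuler := ncard_edges_add_one_le A hA (hq.finite_range_nat hN) (hE.finite_range_nat hN)
    ⟨_, 0, rfl⟩ (by rintro _ ⟨k, rfl⟩; exact ⟨_, rfl⟩)
    (by rintro _ ⟨k, rfl⟩; exact ⟨_, congrArg _ (pathProd_pathTerminus u k)⟩)
  rw [Fintype.card_fin] at heuler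
  omega

theorem exists_eq_closure_pow_pair_of_pathProd {A : Subgroup (FreeGroup (Fin 2))}
    {u : ℕ → Fin 2 × Bool} (hA : Function.Surjective (RatChar.res A)) (hℓ : 0 < ℓ) (hm : 2 ≤ m)
    (hu : Function.Periodic u ℓ)
    (hred : ∀ k, (u (k + 1)).1 = (u k).1 → (u (k + 1)).2 = (u k).2)
    (hcent : ∀ g, Commute g (pathProd u ℓ) → g ∈ Subgroup.zpowers (pathProd u ℓ))
    (hmA : pathProd u ℓ ^ m ∈ A) (hmin : ∀ z : ℤ, pathProd u ℓ ^ z ∈ A → (m : ℤ) ∣ z) :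
    ∃ y, A = Subgroup.closure {pathProd u ℓ ^ m, y} := by
  obtain ⟨k₀, honce₀⟩ := exists_pathEdge_traversed_once hA hℓ hm hu hred hcent hmA hmin
  obtain ⟨-, hE⟩ := pathEdge_periodic hu hmA
  have hN : 0 < m * ℓ := Nat.mul_pos (by omega) hℓ
  obtain ⟨k, hk, honce⟩ : ∃ k < m * ℓ, ∀ j, pathEdge A u j = pathEdge A u k →
      j ≡ k [MOD m * ℓ] :=
    ⟨k₀ % (m * ℓ), Nat.mod_lt _ hN, fun j hj =>
      (honce₀ j (hj.trans (hE.map_mod_nat k₀))).trans (Nat.mod_modEq _ _).symm⟩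
  set c := pathProd u ℓ ^ m with hc
  have hcN : pathProd u (m * ℓ) = c := by
    have := pathProd_add_mul_period hu 0 m
    rwa [zero_add, pathProd, one_mul] at this
  have hmk : ∀ g : FreeGroup (Fin 2), ((g * c⁻¹ : FreeGroup (Fin 2)) : FreeGroup (Fin 2) ⧸ A) = g :=
    fun g => by
      rw [QuotientGroup.eq, mul_inv_rev, mul_assoc, inv_mul_cancel, mul_one, inv_inv]
      exact hmA
  have hne : ∀ j, j < m * ℓ → j ≠ k → pathEdge A u j ≠ pathEdge A u k := fun j hj hjk h =>
    hjk (Nat.ModEq.eq_of_lt_of_lt (honce j h) hj hk)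
  have hedge : ∀ j, ((if (u j).2 then pathProd u j else pathProd u (j + 1) :
      FreeGroup (Fin 2)) : FreeGroup (Fin 2) ⧸ A) = pathProd u (pathOrigin u j) := fun j => by
    unfold pathOrigin
    split_ifs <;> rfl
  have hfst : ∀ j ≤ k, AvoidsEdge A (pathEdge A u k) (pathProd u j) := by
    intro j hj
    induction j with
    | zero => exact .one
    | succ j ih =>
      refine (avoidsEdge_mk_mul_iff ?_).mpr (ih (by omega))
      rw [← pathProd_succ, hedge]
      exact hne j (by omega) (by omega)
  have hsnd : ∀ d j, j + d = m * ℓ → k < j →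
      AvoidsEdge A (pathEdge A u k) (pathProd u j * c⁻¹) := by
    intro d
    induction d with
    | zero =>
      rintro j hj -
      rw [add_zero] at hj
      rw [hj, hcN, mul_inv_cancel]
      exact .one
    | succ d ih =>
      intro j hj hkj
      have h1 := ih (j + 1) (by omega) (by omega)
      rw [pathProd_succ, mul_assoc] at h1
      refine (avoidsEdge_mk_mul_iff ?_).mp h1
      rw [← mul_assoc, ← pathProd_succ, ← ite_mul, hmk, hedge]
      exact hne j (by omega) (by omega)
  have hp := hfst k le_rfl
  have hp' := hsnd (m * ℓ - (k + 1)) (k + 1) (by omega) (by omega)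
  have hterm := pathProd_pathTerminus u k
  unfold pathEdge at hp hp'
  unfold pathTerminus at hterm
  unfold pathOrigin at hp hp' hterm
  cases hb : (u k).2
  · simp only [hb, Bool.false_eq_true, if_false] at hp hp' hterm
    rw [← hmk (pathProd u (k + 1))] at hp hp'
    obtain ⟨y, hy⟩ := exists_eq_closure_pair_of_avoidsEdge hA hp' hp (A.inv_mem hmA)
      (by rw [hterm, mul_assoc])
    refine ⟨y, hy.trans ?_⟩
    rw [← Set.singleton_union, ← Set.singleton_union, Subgroup.closure_union,
      Subgroup.closure_union, ← Set.inv_singleton, Subgroup.closure_inv]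
  · simp only [hb, if_true] at hp hp' hterm
    exact exists_eq_closure_pair_of_avoidsEdge hA hp hp' hmA
      (by rw [inv_mul_cancel_right, hterm])

end Stacking

theorem conj_mem_closure_pair {G : Type*} [Group G] {a b x : G} (h : G)
    (hx : x ∈ Subgroup.closure {a, b}) :
    h * x * h⁻¹ ∈ Subgroup.closure {h * a * h⁻¹, h * b * h⁻¹} := by
  have := Subgroup.mem_map_of_mem (MulAut.conj h).toMonoidHom hx
  rw [MonoidHom.map_closure, Set.image_pair] at this
  exact this

theorem closure_conj_pair_eq_top {G : Type*} [Group G] {a b : G} (h : G)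
    (hab : Subgroup.closure {a, b} = ⊤) :
    Subgroup.closure {h * a * h⁻¹, h * b * h⁻¹} = ⊤ := by
  refine (Subgroup.eq_top_iff' _).mpr fun x => ?_
  have := conj_mem_closure_pair (x := h⁻¹ * x * h) h (hab ▸ Subgroup.mem_top _)
  simpa [mul_assoc] using this

/-- If every rational character of `A ≤ F₂` extends to `F₂` and `A` meets a maximal cyclic
subgroup `⟨r⟩` in `⟨r ^ m⟩` with `m ≥ 2`, then `r ^ m` is one of two generators of `A`. -/
theorem exists_eq_closure_pow_pair {A : Subgroup (FreeGroup (Fin 2))}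
    (hA : Function.Surjective (RatChar.res A)) {r : FreeGroup (Fin 2)} (hr : r ≠ 1)
    (hcent : ∀ g, Commute g r → g ∈ Subgroup.zpowers r) {m : ℕ} (hm : 2 ≤ m)
    (hmA : r ^ m ∈ A) (hmin : ∀ z : ℤ, r ^ z ∈ A → (m : ℤ) ∣ z) :
    ∃ y, A = Subgroup.closure {r ^ m, y} := by
  obtain ⟨g, u, ℓ, hℓ, hu, hred, hgr⟩ := exists_conj_eq_pathProd hr
  have hpow : ∀ z : ℤ, (g * r * g⁻¹) ^ z = g * r ^ z * g⁻¹ := fun z => conj_zpow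
  set A' := A.map (MulAut.conj g).toMonoidHom with hA'
  have hmem : ∀ {x}, g * x * g⁻¹ ∈ A' ↔ x ∈ A := fun {x} => by
    rw [hA']
    exact Subgroup.mem_map_iff_mem (f := (MulAut.conj g).toMonoidHom) (MulAut.conj g).injective
  have hsurj : Function.Surjective (RatChar.res A') := by
    intro χ
    let f : A →* A' :=
      (((MulAut.conj g).toMonoidHom.comp A.subtype).codRestrict A' fun a => hmem.mpr a.2)
    obtain ⟨ψ, hψ⟩ := hA (χ.comp (MonoidHom.toAdditive f))
    refine ⟨ψ, ?_⟩
    ext a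
    obtain ⟨_, a, ha, rfl⟩ := a
    have h1 : ψ (Additive.ofMul a) = χ (Additive.ofMul (f ⟨a, ha⟩)) :=
      DFunLike.congr_fun hψ (Additive.ofMul ⟨a, ha⟩)
    have h2 : ψ (Additive.ofMul (g * a * g⁻¹)) = ψ (Additive.ofMul a) := by
      rw [ofMul_mul, ofMul_mul, ofMul_inv, map_add, map_add, map_neg]
      ring
    exact h2.trans h1
  obtain ⟨y, hy⟩ := exists_eq_closure_pow_pair_of_pathProd (A := A') hsurj hℓ hm hu hred
    (fun h hh => by
      rw [← hgr] at hh ⊢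
      have h1 : Commute (g⁻¹ * h * g) r := by
        have h2 := (Commute.conj_iff g⁻¹).mpr hh
        rwa [show g⁻¹ * (g * r * g⁻¹) * g⁻¹⁻¹ = r by group, inv_inv] at h2
      obtain ⟨z, hz⟩ := hcent _ h1
      refine ⟨z, ?_⟩
      simp only at hz ⊢
      rw [hpow, hz]
      group)
    (by rw [← hgr, ← zpow_natCast, hpow, hmem, zpow_natCast]; exact hmA)
    (fun z hz => hmin z (by rwa [← hgr, hpow, hmem] at hz))
  rw [← hgr, conj_pow] at hy
  refine ⟨g⁻¹ * y * g, le_antisymm (fun x hx => ?_) ?_⟩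
  · have h1 : g * x * g⁻¹ ∈ A' := hmem.mpr hx
    rw [hy] at h1
    have h2 := conj_mem_closure_pair g⁻¹ h1
    rw [inv_inv] at h2
    convert h2 using 2 <;> group
  · have hyA' : y ∈ A' := hy ▸ Subgroup.subset_closure (by simp)
    rw [Subgroup.closure_le]
    rintro x (rfl | rfl)
    · exact hmA
    · refine hmem.mp ?_
      convert hyA' using 1
      group

theorem exists_ratChar_eq {B : Type*} [Group B] [IsFreeGroup B]
    [Subsingleton (IsFreeGroup.Generators B)] {c : B} (hc : c ≠ 1) (v : ℚ) :
    ∃ χ : RatChar B, χ (Additive.ofMul c) = v := by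
  obtain ⟨χ, hχ⟩ := RatChar.exists_eq_on_generators (G := B) (fun _ => 1)
  obtain ⟨y, hy⟩ := IsFreeGroup.exists_forall_mem_zpowers B
  have hval : ∀ z : ℤ, χ (Additive.ofMul (y ^ z)) = z * χ (Additive.ofMul y) := fun z => by
    rw [ofMul_zpow, map_zsmul, zsmul_eq_mul]
  obtain ⟨i⟩ : Nonempty (IsFreeGroup.Generators B) := by
    by_contra hemp
    rw [not_nonempty_iff] at hemp
    exact hc ((IsFreeGroup.toFreeGroup B).injective (Subsingleton.elim _ _))
  have hyne : χ (Additive.ofMul y) ≠ 0 := by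
    intro h0
    obtain ⟨z, hz⟩ := hy (IsFreeGroup.of i)
    have h1 := hχ i
    rw [← hz] at h1
    simp only [hval, h0, mul_zero] at h1
    exact zero_ne_one h1
  obtain ⟨n, rfl⟩ := hy c
  simp only at hc ⊢
  have hn : (n : ℚ) ≠ 0 := by
    rintro h0
    rw [Int.cast_eq_zero] at h0
    simp [h0] at hc
  refine ⟨(v / (n * χ (Additive.ofMul y))) • χ, ?_⟩
  rw [AddMonoidHom.smul_apply, hval, smul_eq_mul, div_mul_cancel₀ _ (mul_ne_zero hn hyne)]

section Amalgam

variable {G : Type*} [Group G] {A B : Subgroup G}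

theorem SplitsAsAmalgam.sup_eq_top (h : SplitsAsAmalgam A B) : A ⊔ B = ⊤ := by
  refine (Subgroup.eq_top_iff' _).mpr fun x => ?_
  obtain ⟨z, rfl⟩ := h.2.2.2 x
  induction z using Monoid.PushoutI.induction_on with
  | of b g =>
    rw [amalgToGroup, Monoid.PushoutI.lift_of]
    cases b
    · exact Subgroup.mem_sup_right g.2
    · exact Subgroup.mem_sup_left g.2
  | base c =>
    rw [amalgToGroup, Monoid.PushoutI.lift_base]
    exact Subgroup.mem_sup_left c.2.1
  | mul x y hx hy =>
    rw [map_mul]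
    exact Subgroup.mul_mem _ hx hy

/-- `A` and `B` are glued along `A ⊓ B` as far as rational characters are concerned. -/
def RatCharsGlue (A B : Subgroup G) : Prop :=
  ∀ (φ : RatChar A) (ψ : RatChar B),
    (∀ x (hA : x ∈ A) (hB : x ∈ B),
      φ (Additive.ofMul ⟨x, hA⟩) = ψ (Additive.ofMul ⟨x, hB⟩)) →
    ∃ χ : RatChar G, RatChar.res A χ = φ ∧ RatChar.res B χ = ψ

theorem RatCharsGlue.symm (h : RatCharsGlue A B) : RatCharsGlue B A := fun φ ψ hφψ =>
  (h ψ φ fun x hA hB => (hφψ x hB hA).symm).imp fun _ hχ => hχ.symm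

theorem SplitsAsAmalgam.ratCharsGlue (h : SplitsAsAmalgam A B) : RatCharsGlue A B := by
  intro φ ψ hφψ
  let f : ∀ b, amalgFam A B b →* Multiplicative ℚ := fun b =>
    match b with
    | true => MonoidHom.toAdditiveLeft.symm φ
    | false => MonoidHom.toAdditiveLeft.symm ψ
  let L : Monoid.PushoutI (amalgMaps A B) →* Multiplicative ℚ :=
    Monoid.PushoutI.lift f
      ((MonoidHom.toAdditiveLeft.symm φ).comp (Subgroup.inclusion inf_le_left)) (by
        rintro (_ | _)
        · ext x
          exact (hφψ x x.2.1 x.2.2).symm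
        · rfl)
  let e := MulEquiv.ofBijective (amalgToGroup A B) h.2.2
  have key : ∀ (b : Bool) (x : amalgFam A B b), L (e.symm (x : G)) = f b x := by
    intro b x
    have h1 : (x : G) = e (Monoid.PushoutI.of b x) := by
      simp only [e, MulEquiv.ofBijective_apply, amalgToGroup, Monoid.PushoutI.lift_of]
      rfl
    rw [h1, MulEquiv.symm_apply_apply]
    exact Monoid.PushoutI.lift_of _ _ _ _
  refine ⟨MonoidHom.toAdditiveLeft (L.comp e.symm.toMonoidHom), ?_, ?_⟩
  · ext a
    exact key true a
  · ext b
    exact key false b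

end Amalgam

theorem subsingleton_generators_or_of_ratCharsGlue {A B : Subgroup (FreeGroup (Fin 2))}
    (h : RatCharsGlue A B) {c : FreeGroup (Fin 2)} (hc : A ⊓ B = Subgroup.zpowers c) :
    Subsingleton (IsFreeGroup.Generators A) ∨ Subsingleton (IsFreeGroup.Generators B) := by
  classical
  by_contra! hne
  obtain ⟨⟨a₁, a₂, ha⟩, ⟨b₁, b₂, hb⟩⟩ := hne
  obtain ⟨hcA, hcB⟩ : c ∈ A ⊓ B := hc ▸ Subgroup.mem_zpowers c
  obtain ⟨φ₁, hφ₁⟩ := RatChar.exists_eq_on_generators (G := A) (Pi.single a₁ 1)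
  obtain ⟨φ₂, hφ₂⟩ := RatChar.exists_eq_on_generators (G := A) (Pi.single a₂ 1)
  obtain ⟨ψ₁, hψ₁⟩ := RatChar.exists_eq_on_generators (G := B) (Pi.single b₁ 1)
  obtain ⟨ψ₂, hψ₂⟩ := RatChar.exists_eq_on_generators (G := B) (Pi.single b₂ 1)
  let cA := Additive.ofMul (⟨c, hcA⟩ : A)
  let cB := Additive.ofMul (⟨c, hcB⟩ : B)
  let δ : (Fin 4 → ℚ) →ₗ[ℚ] ℚ := φ₁ cA • LinearMap.proj 0 + φ₂ cA • LinearMap.proj 1 -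
    ψ₁ cB • LinearMap.proj 2 - ψ₂ cB • LinearMap.proj 3
  let ev : RatChar (FreeGroup (Fin 2)) →ₗ[ℚ] (Fin 4 → ℚ) :=
    RatChar.eval ![((IsFreeGroup.of a₁ : A) : FreeGroup (Fin 2)), (IsFreeGroup.of a₂ : A),
      (IsFreeGroup.of b₁ : B), (IsFreeGroup.of b₂ : B)]
  have hker : LinearMap.ker δ ≤ LinearMap.range ev := by
    intro v hv
    have hv' : φ₁ cA * v 0 + φ₂ cA * v 1 - ψ₁ cB * v 2 - ψ₂ cB * v 3 = 0 := hv
    obtain ⟨χ, hχA, hχB⟩ := h (v 0 • φ₁ + v 1 • φ₂) (v 2 • ψ₁ + v 3 • ψ₂) (by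
      intro x hxA hxB
      obtain ⟨n, rfl⟩ : x ∈ Subgroup.zpowers c := hc ▸ ⟨hxA, hxB⟩
      change (v 0 • φ₁ + v 1 • φ₂) (n • cA) = (v 2 • ψ₁ + v 3 • ψ₂) (n • cB)
      rw [map_zsmul, map_zsmul]
      congr 1
      simp only [AddMonoidHom.add_apply, AddMonoidHom.smul_apply, smul_eq_mul]
      linarith)
    have h1 : ∀ i, χ (Additive.ofMul ((IsFreeGroup.of i : A) : FreeGroup (Fin 2))) =
        v 0 * (Pi.single a₁ (1 : ℚ) : _ → ℚ) i + v 1 * (Pi.single a₂ (1 : ℚ) : _ → ℚ) i := by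
      intro i
      rw [← RatChar.res_apply, hχA, ← hφ₁, ← hφ₂]
      rfl
    have h2 : ∀ i, χ (Additive.ofMul ((IsFreeGroup.of i : B) : FreeGroup (Fin 2))) =
        v 2 * (Pi.single b₁ (1 : ℚ) : _ → ℚ) i + v 3 * (Pi.single b₂ (1 : ℚ) : _ → ℚ) i := by
      intro i
      rw [← RatChar.res_apply, hχB, ← hψ₁, ← hψ₂]
      rfl
    refine ⟨χ, ?_⟩
    ext k
    fin_cases k
    · exact (h1 a₁).trans (by simp [ha])
    · exact (h1 a₂).trans (by simp [ha.symm])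
    · exact (h2 b₁).trans (by simp [hb])
    · exact (h2 b₂).trans (by simp [hb.symm])
  have h1 := Submodule.finrank_mono hker
  have h2 := LinearMap.finrank_range_add_finrank_ker δ
  have h3 := Submodule.finrank_le (LinearMap.range δ)
  have h4 := LinearMap.finrank_range_le ev
  have h5 := RatChar.finrank_freeGroup_le (α := Fin 2)
  rw [Module.finrank_fin_fun] at h2
  rw [Module.finrank_self] at h3
  rw [Fintype.card_fin] at h5
  omega

theorem exists_pow_mem_and_dvd {G : Type*} [Group G] (A : Subgroup G) {r : G} {n : ℤ}
    (hn : n ≠ 0) (hr : r ^ n ∈ A) :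
    ∃ m : ℕ, 0 < m ∧ r ^ m ∈ A ∧ ∀ z : ℤ, r ^ z ∈ A → (m : ℤ) ∣ z := by
  classical
  have hex : ∃ m : ℕ, 0 < m ∧ r ^ m ∈ A := by
    refine ⟨n.natAbs, Int.natAbs_pos.mpr hn, ?_⟩
    rw [← zpow_natCast]
    rcases Int.natAbs_eq n with h | h
    · rwa [← h]
    · rw [← A.inv_mem_iff, ← zpow_neg, ← h]
      exact hr
  obtain ⟨hpos, hmem⟩ := Nat.find_spec hex
  refine ⟨Nat.find hex, hpos, hmem, fun z hz => ?_⟩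
  set m := Nat.find hex with hm
  have hmz : (m : ℤ) ≠ 0 := by exact_mod_cast hpos.ne'
  have hnonneg := Int.emod_nonneg z hmz
  have hlt := Int.emod_lt_of_pos z (by exact_mod_cast hpos : (0 : ℤ) < m)
  have hmod : r ^ (z % m).toNat ∈ A := by
    rw [← zpow_natCast, Int.toNat_of_nonneg hnonneg, Int.emod_def, zpow_sub, zpow_mul,
      zpow_natCast]
    exact A.mul_mem hz (A.inv_mem (A.zpow_mem hmem _))
  by_contra hdvd
  rw [Int.dvd_iff_emod_eq_zero] at hdvd
  exact Nat.find_min hex (m := (z % m).toNat) (by omega) ⟨by omega, hmod⟩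

/-- In a cyclic splitting of `F₂` with a cyclic factor `B`, the factor `A` is `⟨r ^ m, y⟩` for a
basis `(r, y)`. -/
theorem exists_basis_of_ratCharsGlue {A B : Subgroup (FreeGroup (Fin 2))}
    (h : RatCharsGlue A B) (hsup : A ⊔ B = ⊤) (hBA : ¬ B ≤ A) {c : FreeGroup (Fin 2)}
    (hc1 : c ≠ 1) (hc : A ⊓ B = Subgroup.zpowers c)
    (hB : Subsingleton (IsFreeGroup.Generators B)) :
    ∃ r y, ∃ m : ℕ, 2 ≤ m ∧ Subgroup.closure {r, y} = ⊤ ∧ A = Subgroup.closure {r ^ m, y} ∧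
      B ≤ Subgroup.zpowers r := by
  obtain ⟨hcA, hcB⟩ : c ∈ A ⊓ B := hc ▸ Subgroup.mem_zpowers c
  have hsurj : Function.Surjective (RatChar.res A) := by
    intro φ
    obtain ⟨ψ, hψ⟩ := exists_ratChar_eq (B := B) (c := ⟨c, hcB⟩)
      (fun h => hc1 (congrArg Subtype.val h)) (φ (Additive.ofMul ⟨c, hcA⟩))
    obtain ⟨χ, hχ, -⟩ := h φ ψ (by
      intro x hxA hxB
      obtain ⟨n, rfl⟩ : x ∈ Subgroup.zpowers c := hc ▸ ⟨hxA, hxB⟩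
      change φ (n • Additive.ofMul (⟨c, hcA⟩ : A)) = ψ (n • Additive.ofMul (⟨c, hcB⟩ : B))
      rw [map_zsmul, map_zsmul, hψ])
    exact ⟨χ, hχ⟩
  obtain ⟨b, hb⟩ := IsFreeGroup.exists_forall_mem_zpowers B
  have hBb : ∀ x ∈ B, x ∈ Subgroup.zpowers (b : FreeGroup (Fin 2)) := fun x hx => by
    obtain ⟨k, hk⟩ := hb ⟨x, hx⟩
    exact ⟨k, congrArg Subtype.val hk⟩
  have hb1 : (b : FreeGroup (Fin 2)) ≠ 1 := by
    intro hb1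
    have := hBb c hcB
    rw [hb1, Subgroup.zpowers_one_eq_bot, Subgroup.mem_bot] at this
    exact hc1 this
  obtain ⟨r, hbr, hcent⟩ := FreeGroup.exists_root hb1
  have hBr : B ≤ Subgroup.zpowers r := fun x hx =>
    Subgroup.zpowers_le.mpr hbr (hBb x hx)
  have hr1 : r ≠ 1 := by
    rintro rfl
    rw [Subgroup.zpowers_one_eq_bot, Subgroup.mem_bot] at hbr
    exact hb1 hbr
  obtain ⟨n, hn⟩ := hBr hcB
  simp only at hn
  obtain ⟨m, hpos, hmA, hmin⟩ := exists_pow_mem_and_dvd A (r := r) (n := n)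
    (by rintro rfl; exact hc1 (by rw [← hn, zpow_zero])) (hn ▸ hcA)
  have hm : 2 ≤ m := by
    by_contra hm
    obtain rfl : m = 1 := by omega
    rw [pow_one] at hmA
    exact hBA (hBr.trans (Subgroup.zpowers_le.mpr hmA))
  obtain ⟨y, hy⟩ := exists_eq_closure_pow_pair hsurj hr1 hcent hm hmA hmin
  refine ⟨r, y, m, hm, ?_, hy, hBr⟩
  have hr : r ∈ Subgroup.closure {r, y} := Subgroup.subset_closure (by simp)
  rw [eq_top_iff, ← hsup, hy]
  refine sup_le ((Subgroup.closure_le _).mpr ?_) (hBr.trans (Subgroup.zpowers_le.mpr hr))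
  rintro x (rfl | rfl)
  · exact Subgroup.pow_mem _ hr m
  · exact Subgroup.subset_closure (by simp)

/-- If `w ∈ F₂` is non-trivial, not a proper power, and not contained in any subgroup
`⟨xⁿ, y⟩` for a basis `(x, y)` of `F₂` and `n ≥ 2`, then `F₂` has no cyclic splitting as
an amalgamated product relative to `w`. -/
theorem no_relative_cyclic_amalgam_splitting (w : FreeGroup (Fin 2)) (hw : w ≠ 1)
    (hpow : ¬ IsProperPower w)
    (hsub : ∀ (x y : FreeGroup (Fin 2)) (n : ℕ), 2 ≤ n →
      Subgroup.closure {x, y} = ⊤ → w ∉ Subgroup.closure {x ^ n, y}) :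
    ¬ ∃ A B : Subgroup (FreeGroup (Fin 2)),
        SplitsAsAmalgam A B ∧
        (∃ c : FreeGroup (Fin 2), c ≠ 1 ∧ A ⊓ B = Subgroup.zpowers c) ∧
        (∃ g : FreeGroup (Fin 2), g * w * g⁻¹ ∈ A ∨ g * w * g⁻¹ ∈ B) := by
  rintro ⟨A, B, hAB, ⟨c, hc1, hc⟩, g, hg⟩
  have key : ∀ r y, ∀ m : ℕ, 2 ≤ m → Subgroup.closure {r, y} = ⊤ →
      g * w * g⁻¹ ∉ Subgroup.closure {r ^ m, y} := by
    intro r y m hm hry hmem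
    have h1 := conj_mem_closure_pair g⁻¹ hmem
    rw [← conj_pow] at h1
    refine hsub _ _ m hm (closure_conj_pair_eq_top g⁻¹ hry) ?_
    convert h1 using 1
    group
  have main : ∀ {A B : Subgroup (FreeGroup (Fin 2))}, RatCharsGlue A B → A ⊔ B = ⊤ → ¬ B ≤ A →
      A ⊓ B = Subgroup.zpowers c → Subsingleton (IsFreeGroup.Generators B) →
      ¬ (g * w * g⁻¹ ∈ A ∨ g * w * g⁻¹ ∈ B) := by
    intro A B hglue hsup hBA hc hB hg
    obtain ⟨r, y, m, hm, hry, hA, hBr⟩ := exists_basis_of_ratCharsGlue hglue hsup hBA hc1 hc hB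
    rcases hg with hg | hg
    · exact key r y m hm hry (hA ▸ hg)
    · rw [Set.pair_comm] at hry
      refine key y r 2 le_rfl hry ?_
      exact Subgroup.zpowers_le.mpr (Subgroup.subset_closure (by simp)) (hBr hg)
  have hglue := hAB.ratCharsGlue
  rcases subsingleton_generators_or_of_ratCharsGlue hglue hc with hA | hB
  · exact main hglue.symm (sup_comm A B ▸ hAB.sup_eq_top)
      (fun h => hAB.1 (inf_eq_left.mpr h).symm) (inf_comm A B ▸ hc) hA hg.symm
  · exact main hglue hAB.sup_eq_top (fun h => hAB.2.1 (inf_eq_right.mpr h).symm) hc hB hg
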